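/- arXiv:2605.23731 — 7 statements merged into one kernel-verified Lean document; each statement's English description precedes it below -/
import Mathlib

section
/- Let d ≥ 1 and let f : ℝ^d → ℝ be twice continuously differentiable. Then for every x ∈ ℝ^d, Δ_ε f(x)/ε² → Δf(x)/(2d) as ε → 0⁺, where Δf(x) is the trace of the Hessian of f at x. -/
open MeasureTheory Matrix

/-- The Hessian matrix of `f : ℝ^d → ℝ` at `x`. -/
noncomputable def hessianMatrix {d : ℕ} (f : EuclideanSpace ℝ (Fin d) → ℝ)
    (x : EuclideanSpace ℝ (Fin d)) : Matrix (Fin d) (Fin d) ℝ :=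
  Matrix.of fun i j =>
    iteratedFDeriv ℝ 2 f x ![EuclideanSpace.single i (1:ℝ), EuclideanSpace.single j (1:ℝ)]

/-- `Δ_ε f(x) = ⨍_{S^{d-1}} (f(x+εy) − f(x)) dσ(y)`, the average with respect to the
normalized surface measure on the unit sphere. -/
noncomputable def deltaEps {d : ℕ} (f : EuclideanSpace ℝ (Fin d) → ℝ) (ε : ℝ)
    (x : EuclideanSpace ℝ (Fin d)) : ℝ :=
  ⨍ y : Metric.sphere (0 : EuclideanSpace ℝ (Fin d)) 1,
    (f (x + ε • (y : EuclideanSpace ℝ (Fin d))) - f x) ∂(volume.toSphere)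

open scoped Pointwise in
/-- The surface measure of the unit sphere is invariant under linear isometries. -/
theorem LinearIsometryEquiv.integral_comp_toSphere {E F : Type*} [NormedAddCommGroup E]
    [InnerProductSpace ℝ E] [FiniteDimensional ℝ E] [MeasurableSpace E] [BorelSpace E]
    [NormedAddCommGroup F] [NormedSpace ℝ F] (A : E ≃ₗᵢ[ℝ] E) (g : E → F) :
    ∫ y : Metric.sphere (0 : E) 1, g (A y) ∂(volume.toSphere) =
      ∫ y : Metric.sphere (0 : E) 1, g y ∂(volume.toSphere) := by
  let e : Metric.sphere (0 : E) 1 ≃ₜ Metric.sphere (0 : E) 1 :=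
    A.toHomeomorph.subtype fun y => by simp
  have he : MeasurePreserving e (volume : Measure E).toSphere (volume : Measure E).toSphere := by
    refine ⟨e.measurable, Measure.ext fun s hs => ?_⟩
    rw [Measure.map_apply e.measurable hs, Measure.toSphere_apply' _ hs,
      Measure.toSphere_apply' _ (e.measurable hs)]
    congr 1
    have : Set.Ioo (0 : ℝ) 1 • (((↑) : Metric.sphere (0 : E) 1 → E) '' (e ⁻¹' s)) =
        A ⁻¹' (Set.Ioo (0 : ℝ) 1 • (((↑) : Metric.sphere (0 : E) 1 → E) '' s)) := by
      ext z
      simp only [Set.mem_smul, Set.mem_image, Set.mem_preimage]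
      constructor
      · rintro ⟨r, hr, _, ⟨y, hy, rfl⟩, rfl⟩
        exact ⟨r, hr, _, ⟨e y, hy, rfl⟩, (A.map_smul r (y : E)).symm⟩
      · rintro ⟨r, hr, _, ⟨y, hy, rfl⟩, hz⟩
        refine ⟨r, hr, _, ⟨e.symm y, by simpa using hy, rfl⟩, A.injective ?_⟩
        rw [A.map_smul, ← hz]
        congr 1
        exact congrArg Subtype.val (e.apply_symm_apply y)
    rw [this]
    exact A.measurePreserving.measure_preimage_equiv (f := A.toHomeomorph.toMeasurableEquiv) _
  exact he.integral_comp e.measurableEmbedding fun y => g y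

/-- Second-order Taylor formula with Peano remainder. -/
theorem ContDiff.taylor_two_isLittleO {E F : Type*} [NormedAddCommGroup E] [NormedSpace ℝ E]
    [NormedAddCommGroup F] [NormedSpace ℝ F] {f : E → F} (hf : ContDiff ℝ 2 f) (x : E) :
    (fun h => f (x + h) - f x - fderiv ℝ f x h - (1 / 2 : ℝ) • fderiv ℝ (fderiv ℝ f) x h h)
      =o[nhds 0] fun h => ‖h‖ ^ 2 := by
  have hsymm : IsSymmSndFDerivAt ℝ f x := hf.contDiffAt.isSymmSndFDerivAt (by simp)
  have hf' : HasFDerivAt (fderiv ℝ f) (fderiv ℝ (fderiv ℝ f) x) x :=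
    ((hf.fderiv_right (m := 1) (by norm_num)).differentiable (by norm_num) x).hasFDerivAt
  set B := fderiv ℝ (fderiv ℝ f) x with hB
  have hR : ∀ h, HasFDerivAt
      (fun h => f (x + h) - f x - fderiv ℝ f x h - (1 / 2 : ℝ) • B h h)
      (fderiv ℝ f (x + h) - fderiv ℝ f x - B h) h := by
    intro h
    have h1 : HasFDerivAt (fun h => f (x + h)) (fderiv ℝ f (x + h)) h := by
      have := (hf.differentiable (by norm_num) (x + h)).hasFDerivAt
      rwa [hasFDerivAt_comp_add_left]
    have h2 := (B.hasFDerivAt (x := h)).clm_apply (hasFDerivAt_id h)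
    refine (((h1.sub_const (f x)).sub (fderiv ℝ f x).hasFDerivAt).sub
      (h2.const_smul (1 / 2 : ℝ))).congr_fderiv ?_
    ext v
    have := hsymm v h
    simp only [← hB] at this
    simp [this, ← add_smul, ← two_mul]
  rw [hasFDerivAt_iff_isLittleO_nhds_zero] at hf'
  rw [Asymptotics.isLittleO_iff]
  intro c hc
  obtain ⟨δ, hδ, H⟩ := Metric.eventually_nhds_iff_ball.1 (hf'.def hc)
  filter_upwards [Metric.ball_mem_nhds (0 : E) hδ] with h hh
  have := (convex_closedBall (0 : E) ‖h‖).norm_image_sub_le_of_norm_hasFDerivWithin_le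
    (C := c * ‖h‖) (x := 0) (y := h) (fun y _ => (hR y).hasFDerivWithinAt)
    (fun y hy => ?_) (by simp) (by simp)
  · simpa [pow_two, mul_assoc] using this
  · have hy' : ‖y‖ ≤ ‖h‖ := by simpa using hy
    have hh' : ‖h‖ < δ := by simpa using hh
    exact (H y (by simpa using hy'.trans_lt hh')).trans (by gcongr)

section SphereMoments

variable {d : ℕ}

theorem Continuous.integrable_toSphere {g : EuclideanSpace ℝ (Fin d) → ℝ} (hg : Continuous g) :
    Integrable (fun y : Metric.sphere (0 : EuclideanSpace ℝ (Fin d)) 1 => g y)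
      volume.toSphere :=
  (hg.comp continuous_subtype_val).integrable_of_hasCompactSupport
    (HasCompactSupport.of_compactSpace _)

theorem integral_clm_toSphere (L : EuclideanSpace ℝ (Fin d) →L[ℝ] ℝ) :
    ∫ y : Metric.sphere (0 : EuclideanSpace ℝ (Fin d)) 1, L y ∂(volume.toSphere) = 0 := by
  have h := (LinearIsometryEquiv.neg ℝ (E := EuclideanSpace ℝ (Fin d))).integral_comp_toSphere L
  simp only [LinearIsometryEquiv.coe_neg, map_neg, integral_neg] at h
  linarith

theorem integral_mul_toSphere_of_ne {i j : Fin d} (hij : i ≠ j) :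
    ∫ y : Metric.sphere (0 : EuclideanSpace ℝ (Fin d)) 1, y.1 i * y.1 j ∂(volume.toSphere)
      = 0 := by
  have h := (LinearIsometryEquiv.piLpCongrRight 2 fun k : Fin d =>
    if k = i then LinearIsometryEquiv.neg ℝ (E := ℝ)
      else LinearIsometryEquiv.refl ℝ ℝ).integral_comp_toSphere
        (fun y : EuclideanSpace ℝ (Fin d) => y i * y j)
  simp only [LinearIsometryEquiv.piLpCongrRight_apply, if_true, if_neg hij.symm,
    LinearIsometryEquiv.coe_neg, LinearIsometryEquiv.coe_refl, id_eq, neg_mul,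
    integral_neg] at h
  linarith

theorem integral_sq_toSphere (i : Fin d) :
    ∫ y : Metric.sphere (0 : EuclideanSpace ℝ (Fin d)) 1, y.1 i * y.1 i ∂(volume.toSphere) =
      (volume : Measure (EuclideanSpace ℝ (Fin d))).toSphere.real Set.univ / d := by
  have hd : (d : ℝ) ≠ 0 := by
    have := i.pos
    positivity
  have hperm : ∀ j : Fin d,
      ∫ y : Metric.sphere (0 : EuclideanSpace ℝ (Fin d)) 1, y.1 j * y.1 j ∂(volume.toSphere) =
      ∫ y : Metric.sphere (0 : EuclideanSpace ℝ (Fin d)) 1, y.1 i * y.1 i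
        ∂(volume.toSphere) := by
    intro j
    have h := (LinearIsometryEquiv.piLpCongrLeft 2 ℝ ℝ (Equiv.swap i j)).integral_comp_toSphere
      (fun y : EuclideanSpace ℝ (Fin d) => y i * y i)
    simpa [LinearIsometryEquiv.piLpCongrLeft_apply, Equiv.piCongrLeft'] using h
  have hsum : ∑ j : Fin d, ∫ y : Metric.sphere (0 : EuclideanSpace ℝ (Fin d)) 1,
      y.1 j * y.1 j ∂(volume.toSphere) =
      (volume : Measure (EuclideanSpace ℝ (Fin d))).toSphere.real Set.univ := by
    rw [← integral_finsetSum _ fun j _ => Continuous.integrable_toSphere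
      (g := fun y => y j * y j) (by fun_prop)]
    have : ∀ y : Metric.sphere (0 : EuclideanSpace ℝ (Fin d)) 1,
        ∑ j, y.1 j * y.1 j = 1 := by
      intro y
      have h := EuclideanSpace.real_norm_sq_eq y.1
      rw [norm_eq_of_mem_sphere y] at h
      simpa [pow_two] using h.symm
    simp [this]
  rw [Finset.sum_congr rfl fun j _ => hperm j] at hsum
  rw [eq_div_iff hd, ← hsum]
  simp [mul_comm]

theorem integral_bilin_toSphere
    (B : EuclideanSpace ℝ (Fin d) →L[ℝ] EuclideanSpace ℝ (Fin d) →L[ℝ] ℝ) :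
    ∫ y : Metric.sphere (0 : EuclideanSpace ℝ (Fin d)) 1, B y y ∂(volume.toSphere) =
      (volume : Measure (EuclideanSpace ℝ (Fin d))).toSphere.real Set.univ / d *
        ∑ i, B (EuclideanSpace.single i 1) (EuclideanSpace.single i 1) := by
  have hB : ∀ y : EuclideanSpace ℝ (Fin d), B y y =
      ∑ i, ∑ j, B (EuclideanSpace.single i 1) (EuclideanSpace.single j 1) * (y i * y j) := by
    intro y
    have hy : y = ∑ i, y i • EuclideanSpace.single i (1 : ℝ) := by
      simpa using ((EuclideanSpace.basisFun (Fin d) ℝ).sum_repr y).symm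
    rw [congrArg (fun z => B z z) hy]
    simp only [map_sum, map_smul, _root_.sum_apply, _root_.smul_apply,
      smul_eq_mul, Finset.mul_sum]
    rw [Finset.sum_comm]
    exact Finset.sum_congr rfl fun i _ => Finset.sum_congr rfl fun j _ => by ring
  refine (integral_congr_ae (Filter.Eventually.of_forall
    fun y : Metric.sphere (0 : EuclideanSpace ℝ (Fin d)) 1 => hB y.1)).trans ?_
  rw [integral_finsetSum _ fun i _ => Continuous.integrable_toSphere
    (g := fun y => ∑ j, B (EuclideanSpace.single i 1) (EuclideanSpace.single j 1) * (y i * y j))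
    (by fun_prop), Finset.mul_sum]
  refine Finset.sum_congr rfl fun i _ => ?_
  rw [integral_finsetSum _ fun j _ => Continuous.integrable_toSphere
    (g := fun y => B (EuclideanSpace.single i 1) (EuclideanSpace.single j 1) * (y i * y j))
    (by fun_prop), Finset.sum_eq_single i]
  · rw [integral_const_mul, integral_sq_toSphere, mul_comm]
  · intro j _ hj
    rw [integral_const_mul, integral_mul_toSphere_of_ne hj.symm, mul_zero]
  · simp

end SphereMoments

/-- `Δ_ε f(x)/ε² → Δf(x)/(2d)` as `ε → 0⁺`. -/
theorem deltaEps_tendsto_laplacian {d : ℕ} (hd : 1 ≤ d)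
    (f : EuclideanSpace ℝ (Fin d) → ℝ) (hf : ContDiff ℝ 2 f)
    (x : EuclideanSpace ℝ (Fin d)) :
    Filter.Tendsto (fun ε : ℝ => deltaEps f ε x / ε ^ 2)
      (nhdsWithin 0 (Set.Ioi 0))
      (nhds ((hessianMatrix f x).trace / (2 * d))) := by
  have hd0 : (d : ℝ) ≠ 0 := by positivity
  have : NeZero d := ⟨by omega⟩
  have hM : 0 < (volume : Measure (EuclideanSpace ℝ (Fin d))).toSphere.real Set.univ := by
    have : NeZero (volume : Measure (EuclideanSpace ℝ (Fin d))).toSphere :=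
      ⟨Measure.toSphere_ne_zero _⟩
    exact measureReal_univ_pos
  set M := (volume : Measure (EuclideanSpace ℝ (Fin d))).toSphere.real Set.univ with hMdef
  set B := fderiv ℝ (fderiv ℝ f) x with hB
  have htr : (hessianMatrix f x).trace =
      ∑ i, B (EuclideanSpace.single i 1) (EuclideanSpace.single i 1) := by
    simp [Matrix.trace, hessianMatrix, iteratedFDeriv_two_apply, hB]
  have hT := hf.taylor_two_isLittleO x
  rw [← hB] at hT
  have hfc := hf.continuous
  rw [Metric.tendsto_nhds]
  intro c hc
  obtain ⟨δ, hδ, H⟩ := Metric.eventually_nhds_iff_ball.1 (hT.def (half_pos hc))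
  filter_upwards [Ioo_mem_nhdsGT hδ] with ε hε
  have hε0 : 0 < ε := hε.1
  have hexp : deltaEps f ε x / ε ^ 2 - (hessianMatrix f x).trace / (2 * d) =
      M⁻¹ * (ε ^ 2)⁻¹ * ∫ y : Metric.sphere (0 : EuclideanSpace ℝ (Fin d)) 1,
        (f (x + ε • y.1) - f x - fderiv ℝ f x (ε • y.1) - (1 / 2 : ℝ) • B (ε • y.1) (ε • y.1))
          ∂(volume.toSphere) := by
    rw [integral_sub (Continuous.integrable_toSphere
        (g := fun y => f (x + ε • y) - f x - fderiv ℝ f x (ε • y)) (by fun_prop))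
      (Continuous.integrable_toSphere
        (g := fun y => (1 / 2 : ℝ) • B (ε • y) (ε • y)) (by fun_prop)),
      integral_sub (Continuous.integrable_toSphere
        (g := fun y => f (x + ε • y) - f x) (by fun_prop))
      (Continuous.integrable_toSphere
        (g := fun y => fderiv ℝ f x (ε • y)) (by fun_prop))]
    simp only [map_smul, _root_.smul_apply, smul_eq_mul, integral_const_mul,
      integral_clm_toSphere, integral_bilin_toSphere, htr, deltaEps, average_eq, ← hMdef]
    field_simp
    ring
  have hbound : ‖∫ y : Metric.sphere (0 : EuclideanSpace ℝ (Fin d)) 1,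
        (f (x + ε • y.1) - f x - fderiv ℝ f x (ε • y.1) - (1 / 2 : ℝ) • B (ε • y.1) (ε • y.1))
          ∂(volume.toSphere)‖ ≤ c / 2 * ε ^ 2 * M := by
    refine norm_integral_le_of_norm_le_const (Filter.Eventually.of_forall fun y => ?_)
    have hn : ‖ε • y.1‖ = ε := by
      rw [norm_smul, norm_eq_of_mem_sphere y, mul_one, Real.norm_of_nonneg hε0.le]
    simpa [hn] using H (ε • y.1) (by simpa [hn] using hε.2)
  rw [Real.dist_eq, hexp, abs_mul, abs_of_pos (by positivity : 0 < M⁻¹ * (ε ^ 2)⁻¹)]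
  calc _ ≤ M⁻¹ * (ε ^ 2)⁻¹ * (c / 2 * ε ^ 2 * M) := by
        gcongr
        exact hbound
    _ = c / 2 := by field_simp
    _ < c := half_lt_self hc
end

section
/- Let d ≥ 1, ℓ ∈ ℝ, and let f : ℝ^d → ℝ be twice continuously differentiable with Δf(x) ≤ ℓ for all x ∈ ℝ^d, where Δf denotes the trace of the Hessian of f. Then for every ε > 0 and every x ∈ ℝ^d, Δ_ε f(x) ≤ (ℓ/d)·(ε²/2). -/
open MeasureTheory Matrix

open Metric Set Pointwise in
/-- The surface measure of the unit sphere is invariant under linear isometries. -/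
lemma integral_toSphere_comp_linearIsometryEquiv {E : Type*} [NormedAddCommGroup E]
    [InnerProductSpace ℝ E] [FiniteDimensional ℝ E] [MeasurableSpace E] [BorelSpace E]
    (e : E ≃ₗᵢ[ℝ] E) {g : E → ℝ} (hg : Continuous g) :
    ∫ y : sphere (0 : E) 1, g (e y) ∂(volume.toSphere) =
      ∫ y : sphere (0 : E) 1, g y ∂(volume.toSphere) := by
  have he (y : sphere (0 : E) 1) : e y ∈ sphere (0 : E) 1 := by simp
  let T : sphere (0 : E) 1 → sphere (0 : E) 1 := fun y ↦ ⟨e y, he y⟩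
  have hT : Continuous T := by fun_prop
  have hmap : (volume : Measure E).toSphere.map T = (volume : Measure E).toSphere := by
    ext s hs
    rw [Measure.map_apply hT.measurable hs, Measure.toSphere_apply' _ (hT.measurable hs),
      Measure.toSphere_apply' _ hs]
    congr 1
    rw [← e.measurePreserving.measure_preimage_emb
      e.toHomeomorph.measurableEmbedding (Ioo (0 : ℝ) 1 • (Subtype.val '' s))]
    congr 1
    ext z
    simp only [Set.mem_smul, mem_image, mem_preimage]
    constructor
    · rintro ⟨r, hr, _, ⟨y, hy, rfl⟩, rfl⟩
      exact ⟨r, hr, _, ⟨T y, hy, rfl⟩, by simp [T]⟩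
    · rintro ⟨r, hr, _, ⟨y, hy, rfl⟩, hz⟩
      have hy' : e.symm y ∈ sphere (0 : E) 1 := by simp
      refine ⟨r, hr, _, ⟨⟨e.symm y, hy'⟩, by simpa [T] using hy, rfl⟩, ?_⟩
      apply e.injective
      simpa using hz
  conv_rhs => rw [← hmap]
  rw [integral_map hT.aemeasurable (by fun_prop)]

open Metric Set in
/-- Differentiation under the integral sign over a compact space. -/
lemma hasDerivAt_integral_of_compactSpace {X : Type*} [TopologicalSpace X] [CompactSpace X]
    [MeasurableSpace X] [OpensMeasurableSpace X] {μ : Measure X} [IsFiniteMeasure μ]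
    {F F' : ℝ → X → ℝ} (hF : Continuous F.uncurry) (hF' : Continuous F'.uncurry)
    (h : ∀ t x, HasDerivAt (F · x) (F' t x) t) (t : ℝ) :
    HasDerivAt (fun t ↦ ∫ x, F t x ∂μ) (∫ x, F' t x ∂μ) t := by
  have hFt (s) : Continuous (F s) := hF.comp (by fun_prop : Continuous fun x : X ↦ (s, x))
  have hFt' (s) : Continuous (F' s) := hF'.comp (by fun_prop : Continuous fun x : X ↦ (s, x))
  obtain ⟨C, hC⟩ := ((isCompact_closedBall t 1).prod isCompact_univ).exists_bound_of_continuousOn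
    hF'.continuousOn
  refine (hasDerivAt_integral_of_dominated_loc_of_deriv_le (bound := fun _ ↦ C)
    (closedBall_mem_nhds t one_pos) (.of_forall fun s ↦ ?_) ?_ ?_ ?_ (integrable_const C) ?_).2
  · exact (hFt s).aestronglyMeasurable_of_compactSpace
  · exact (hFt t).integrable_of_hasCompactSupport (.of_compactSpace _)
  · exact (hFt' t).aestronglyMeasurable_of_compactSpace
  · exact .of_forall fun x s hs ↦ hC (s, x) ⟨hs, mem_univ _⟩
  · exact .of_forall fun x s _ ↦ h s x

section Euclidean

variable {d : ℕ}

local notation "𝔼" => EuclideanSpace ℝ (Fin d)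

/-- The infinitesimal generator of the rotations in the `(i, j)` coordinate plane. -/
noncomputable def rotationGenerator (i j : Fin d) : 𝔼 →L[ℝ] 𝔼 :=
  (EuclideanSpace.proj i).smulRight (EuclideanSpace.single j (1 : ℝ)) -
    (EuclideanSpace.proj j).smulRight (EuclideanSpace.single i (1 : ℝ))

lemma rotationGenerator_apply (i j : Fin d) (y : 𝔼) :
    rotationGenerator i j y =
      y i • EuclideanSpace.single j (1 : ℝ) - y j • EuclideanSpace.single i (1 : ℝ) := by
  simp [rotationGenerator]

lemma norm_add_cos_sub_one_smul_add_sin_smul_rotationGenerator {i j : Fin d}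
    (hij : i ≠ j) (θ : ℝ) (y : 𝔼) :
    ‖y + (Real.cos θ - 1) • (y i • EuclideanSpace.single i (1 : ℝ) +
      y j • EuclideanSpace.single j (1 : ℝ)) + Real.sin θ • rotationGenerator i j y‖ = ‖y‖ := by
  have h : y + (Real.cos θ - 1) • (y i • EuclideanSpace.single i (1 : ℝ) +
      y j • EuclideanSpace.single j (1 : ℝ)) + Real.sin θ • rotationGenerator i j y =
      y + (((Real.cos θ - 1) * y i - Real.sin θ * y j) • EuclideanSpace.single i (1 : ℝ) +
        ((Real.cos θ - 1) * y j + Real.sin θ * y i) • EuclideanSpace.single j (1 : ℝ)) := by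
    rw [rotationGenerator_apply]
    module
  rw [← sq_eq_sq₀ (norm_nonneg _) (norm_nonneg _), h, norm_add_sq_real, norm_add_sq_real]
  simp [norm_smul, inner_add_right, inner_smul_left, inner_smul_right,
    EuclideanSpace.inner_single_right, hij.symm]
  linear_combination (y i ^ 2 + y j ^ 2) * Real.sin_sq_add_cos_sq θ

/-- The rotation by the angle `θ` in the `(i, j)` coordinate plane. -/
noncomputable def planeRotation {i j : Fin d} (hij : i ≠ j) (θ : ℝ) : 𝔼 ≃ₗᵢ[ℝ] 𝔼 :=
  LinearIsometry.toLinearIsometryEquiv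
    { toLinearMap := ((ContinuousLinearMap.id ℝ 𝔼) +
        (Real.cos θ - 1) • ((EuclideanSpace.proj i).smulRight (EuclideanSpace.single i (1 : ℝ)) +
          (EuclideanSpace.proj j).smulRight (EuclideanSpace.single j (1 : ℝ))) +
        Real.sin θ • rotationGenerator i j : 𝔼 →L[ℝ] 𝔼).toLinearMap
      norm_map' := fun y ↦ by simpa using
        norm_add_cos_sub_one_smul_add_sin_smul_rotationGenerator hij θ y } rfl

lemma planeRotation_apply {i j : Fin d} (hij : i ≠ j) (θ : ℝ) (y : 𝔼) :
    planeRotation hij θ y = y + (Real.cos θ - 1) • (y i • EuclideanSpace.single i (1 : ℝ) +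
      y j • EuclideanSpace.single j (1 : ℝ)) + Real.sin θ • rotationGenerator i j y := by
  simp [planeRotation]

lemma hasDerivAt_planeRotation {i j : Fin d} (hij : i ≠ j) (θ : ℝ) (y : 𝔼) :
    HasDerivAt (fun θ ↦ planeRotation hij θ y)
      ((-Real.sin θ) • (y i • EuclideanSpace.single i (1 : ℝ) +
      y j • EuclideanSpace.single j (1 : ℝ)) + Real.cos θ • rotationGenerator i j y) θ := by
  simp only [planeRotation_apply]
  exact ((((Real.hasDerivAt_cos θ).sub_const 1).smul_const _).const_add y).add
    ((Real.hasDerivAt_sin θ).smul_const _)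

/-- Angular derivatives have zero mean on the unit sphere. -/
lemma integral_toSphere_fderiv_rotationGenerator {v : 𝔼 → ℝ} (hv : ContDiff ℝ 1 v) (i j : Fin d) :
    ∫ y : Metric.sphere (0 : 𝔼) 1, fderiv ℝ v y (rotationGenerator i j y) ∂(volume.toSphere)
      = 0 := by
  obtain rfl | hij := eq_or_ne i j
  · simp [rotationGenerator]
  have hv' := hv.continuous_fderiv one_ne_zero
  have hvc := hv.continuous
  have key := hasDerivAt_integral_of_compactSpace (μ := (volume : Measure 𝔼).toSphere)
    (F := fun θ y ↦ v (planeRotation hij θ y))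
    (F' := fun θ y ↦ fderiv ℝ v (planeRotation hij θ y)
      ((-Real.sin θ) • ((y : 𝔼) i • EuclideanSpace.single i (1 : ℝ) +
      (y : 𝔼) j • EuclideanSpace.single j (1 : ℝ)) + Real.cos θ • rotationGenerator i j y))
    (by simp only [planeRotation_apply, Function.uncurry_def]; fun_prop)
    (by simp only [planeRotation_apply, Function.uncurry_def]; fun_prop)
    (fun θ y ↦ ((hv.differentiable one_ne_zero _).hasFDerivAt).comp_hasDerivAt θ
      (hasDerivAt_planeRotation hij θ (y : 𝔼))) 0
  simp only [integral_toSphere_comp_linearIsometryEquiv _ hvc] at key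
  simpa [planeRotation_apply] using key.unique (hasDerivAt_const _ _)

lemma sum_rotationGenerator_rotationGenerator (y : 𝔼) :
    ∑ i, ∑ j, rotationGenerator i j (rotationGenerator i j y) = (-2 * ((d : ℝ) - 1)) • y := by
  ext k
  simp [rotationGenerator_apply, mul_sub, Finset.sum_sub_distrib, Pi.single_apply,
    Finset.sum_ite_eq]
  ring

lemma sum_bilin_rotationGenerator (B : 𝔼 →L[ℝ] 𝔼 →L[ℝ] ℝ) (y : 𝔼) :
    ∑ i, ∑ j, B (rotationGenerator i j y) (rotationGenerator i j y) =
      2 * (‖y‖ ^ 2 * ∑ i, B (EuclideanSpace.single i (1 : ℝ)) (EuclideanSpace.single i (1 : ℝ))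
        - B y y) := by
  set b : Fin d → Fin d → ℝ := fun i j ↦
    B (EuclideanSpace.single i (1 : ℝ)) (EuclideanSpace.single j (1 : ℝ)) with hb
  have hy : y = ∑ i, y i • EuclideanSpace.single i (1 : ℝ) := by
    ext k; simp [Pi.single_apply]
  have hB : B y y = ∑ i, ∑ j, y i * y j * b i j := by
    conv_lhs => rw [hy]
    simp only [map_sum, _root_.sum_apply, map_smul, _root_.smul_apply,
      smul_eq_mul, Finset.mul_sum]
    rw [Finset.sum_comm]
    exact Finset.sum_congr rfl fun i _ ↦ Finset.sum_congr rfl fun j _ ↦ by ring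
  have hpt (i j : Fin d) : B (rotationGenerator i j y) (rotationGenerator i j y) =
      y i ^ 2 * b j j + y j ^ 2 * b i i - (y i * y j * b i j + y j * y i * b j i) := by
    simp only [rotationGenerator_apply, map_sub, map_smul, _root_.sub_apply,
      _root_.smul_apply, smul_eq_mul, hb]
    ring
  have h1 : ∑ i, ∑ j, y i ^ 2 * b j j = (∑ i, y i ^ 2) * ∑ i, b i i :=
    (Finset.sum_mul_sum ..).symm
  have h2 : ∑ i, ∑ j, y j ^ 2 * b i i = (∑ i, y i ^ 2) * ∑ i, b i i := by
    rw [Finset.sum_comm, h1]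
  have h3 : ∑ i, ∑ j, y j * y i * b j i = ∑ i, ∑ j, y i * y j * b i j := Finset.sum_comm
  simp only [hpt, Finset.sum_add_distrib, Finset.sum_sub_distrib, h1, h2, h3, hB,
    EuclideanSpace.real_norm_sq_eq]
  ring

/-- The spherical means of the Laplacian, in polar coordinates. -/
lemma integral_toSphere_laplacian {f : 𝔼 → ℝ} (hf : ContDiff ℝ 2 f) (x : 𝔼) (r : ℝ) :
    r * ∫ y : Metric.sphere (0 : 𝔼) 1, (hessianMatrix f (x + r • (y : 𝔼))).trace
        ∂(volume.toSphere) =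
      r * ∫ y : Metric.sphere (0 : 𝔼) 1, fderiv ℝ (fderiv ℝ f) (x + r • (y : 𝔼)) y y
        ∂(volume.toSphere) +
      ((d : ℝ) - 1) * ∫ y : Metric.sphere (0 : 𝔼) 1, fderiv ℝ f (x + r • (y : 𝔼)) y
        ∂(volume.toSphere) := by
  have hD : ContDiff ℝ 1 (fderiv ℝ f) := hf.fderiv_right (by norm_num)
  have hD' := hD.continuous_fderiv one_ne_zero
  have hDc := hD.continuous
  have hint {g : 𝔼 → ℝ} (hg : Continuous g) :
      Integrable (fun y : Metric.sphere (0 : 𝔼) 1 ↦ g y) (volume.toSphere) :=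
    (hg.comp continuous_subtype_val).integrable_of_hasCompactSupport (.of_compactSpace _)
  have hfd (i j : Fin d) (y w : 𝔼) :
      fderiv ℝ (fun y ↦ fderiv ℝ f (x + r • y) (rotationGenerator i j y)) y w =
        r * fderiv ℝ (fderiv ℝ f) (x + r • y) w (rotationGenerator i j y) +
          fderiv ℝ f (x + r • y) (rotationGenerator i j w) := by
    have h1 : HasFDerivAt (fun y : 𝔼 ↦ x + r • y) (r • ContinuousLinearMap.id ℝ 𝔼) y :=
      ((hasFDerivAt_id y).const_smul r).const_add x
    have h2 := ((hD.differentiable one_ne_zero (x + r • y)).hasFDerivAt).comp y h1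
    have h3 := h2.clm_apply (rotationGenerator i j).hasFDerivAt
    simp only [Function.comp_apply] at h3
    rw [h3.fderiv]
    simp [add_comm]
  have h0 (i j : Fin d) := integral_toSphere_fderiv_rotationGenerator
    (v := fun y ↦ fderiv ℝ f (x + r • y) (rotationGenerator i j y)) (by fun_prop) i j
  simp only [hfd] at h0
  have hsum : ∑ i, ∑ j, ∫ y : Metric.sphere (0 : 𝔼) 1,
      (r * fderiv ℝ (fderiv ℝ f) (x + r • (y : 𝔼)) (rotationGenerator i j y)
        (rotationGenerator i j y) +
      fderiv ℝ f (x + r • (y : 𝔼)) (rotationGenerator i j (rotationGenerator i j y)))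
        ∂(volume.toSphere) = 0 := by simp [h0]
  have htr (z : 𝔼) : (hessianMatrix f z).trace = ∑ i, fderiv ℝ (fderiv ℝ f) z
      (EuclideanSpace.single i (1 : ℝ)) (EuclideanSpace.single i (1 : ℝ)) := by
    simp [hessianMatrix, Matrix.trace, iteratedFDeriv_two_apply]
  have hpt (y : Metric.sphere (0 : 𝔼) 1) : ∑ i, ∑ j,
      (r * fderiv ℝ (fderiv ℝ f) (x + r • (y : 𝔼)) (rotationGenerator i j y)
        (rotationGenerator i j y) +
      fderiv ℝ f (x + r • (y : 𝔼)) (rotationGenerator i j (rotationGenerator i j y))) =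
      2 * r * (hessianMatrix f (x + r • (y : 𝔼))).trace -
      2 * r * fderiv ℝ (fderiv ℝ f) (x + r • (y : 𝔼)) y y
      - 2 * ((d : ℝ) - 1) * fderiv ℝ f (x + r • (y : 𝔼)) y := by
    simp only [Finset.sum_add_distrib, ← Finset.mul_sum, ← map_sum]
    rw [sum_bilin_rotationGenerator, sum_rotationGenerator_rotationGenerator, htr]
    simp only [norm_eq_of_mem_sphere, map_smul, smul_eq_mul]
    ring
  have hi1 : Integrable (fun y : Metric.sphere (0 : 𝔼) 1 ↦
      (hessianMatrix f (x + r • (y : 𝔼))).trace) (volume.toSphere) := by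
    simp only [htr]
    exact hint (g := fun y ↦ ∑ i, fderiv ℝ (fderiv ℝ f) (x + r • y)
      (EuclideanSpace.single i (1 : ℝ)) (EuclideanSpace.single i (1 : ℝ))) (by fun_prop)
  have hi2 := hint (g := fun y ↦ fderiv ℝ (fderiv ℝ f) (x + r • y) y y) (by fun_prop)
  have hi3 := hint (g := fun y ↦ fderiv ℝ f (x + r • y) y) (by fun_prop)
  have hint' (i j : Fin d) := hint (g := fun y ↦
      r * fderiv ℝ (fderiv ℝ f) (x + r • (y : 𝔼)) (rotationGenerator i j y)
        (rotationGenerator i j y) +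
      fderiv ℝ f (x + r • (y : 𝔼)) (rotationGenerator i j (rotationGenerator i j y)))
      (by fun_prop)
  simp_rw [← integral_finsetSum _ fun j _ ↦ hint' _ j] at hsum
  rw [← integral_finsetSum _ fun i _ ↦ integrable_finsetSum _ fun j _ ↦ hint' i j] at hsum
  simp_rw [hpt] at hsum
  have hi12 := (hi1.const_mul (2 * r)).sub (hi2.const_mul (2 * r))
  simp only [Pi.sub_def] at hi12
  rw [integral_sub hi12 (hi3.const_mul _),
    integral_sub (hi1.const_mul _) (hi2.const_mul _)] at hsum
  simp only [integral_const_mul] at hsum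
  linarith

end Euclidean

/-- If `Δf ≤ ℓ` everywhere, then `Δ_ε f ≤ (ℓ/d)·(ε²/2)` for every `ε > 0`. -/
theorem deltaEps_le_of_laplacian_le {d : ℕ} (hd : 1 ≤ d) (ℓ : ℝ)
    (f : EuclideanSpace ℝ (Fin d) → ℝ) (hf : ContDiff ℝ 2 f)
    (hΔf : ∀ x, (hessianMatrix f x).trace ≤ ℓ) :
    ∀ ε : ℝ, 0 < ε → ∀ x : EuclideanSpace ℝ (Fin d),
      deltaEps f ε x ≤ (ℓ / d) * (ε ^ 2 / 2) := by
  intro ε hε x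
  obtain ⟨n, rfl⟩ : ∃ n, d = n + 1 := ⟨d - 1, by omega⟩
  set σ : Measure (Metric.sphere (0 : EuclideanSpace ℝ (Fin (n + 1))) 1) :=
    (volume : Measure (EuclideanSpace ℝ (Fin (n + 1)))).toSphere with hσ
  have hD : ContDiff ℝ 1 (fderiv ℝ f) := hf.fderiv_right (by norm_num)
  have hD' := hD.continuous_fderiv one_ne_zero
  have hDc := hD.continuous
  have hfc := hf.continuous
  set c := σ.real Set.univ with hc
  have hc0 : 0 < c := by
    rw [hc, measureReal_def]
    exact ENNReal.toReal_pos (by simp [hσ, (Metric.measure_ball_pos volume _ one_pos).ne'])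
      (measure_ne_top _ _)
  set φ : ℝ → ℝ := fun r ↦ ∫ y, f (x + r • (y : EuclideanSpace ℝ (Fin (n + 1)))) ∂σ with hφ
  set φ₁ : ℝ → ℝ :=
    fun r ↦ ∫ y, fderiv ℝ f (x + r • (y : EuclideanSpace ℝ (Fin (n + 1)))) y ∂σ with hφ₁
  set φ₂ : ℝ → ℝ := fun r ↦ ∫ y, fderiv ℝ (fderiv ℝ f)
    (x + r • (y : EuclideanSpace ℝ (Fin (n + 1)))) y y ∂σ with hφ₂
  have hline (y : EuclideanSpace ℝ (Fin (n + 1))) (r : ℝ) :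
      HasDerivAt (fun r : ℝ ↦ x + r • y) y r := by
    simpa using ((hasDerivAt_id r).smul_const y).const_add x
  have hdφ (r : ℝ) : HasDerivAt φ (φ₁ r) r :=
    hasDerivAt_integral_of_compactSpace
      (F := fun r (y : Metric.sphere (0 : EuclideanSpace ℝ (Fin (n + 1))) 1) ↦ f (x + r • (y : _)))
      (F' := fun r y ↦ fderiv ℝ f (x + r • (y : _)) y)
      (by simp only [Function.uncurry_def]; fun_prop)
      (by simp only [Function.uncurry_def]; fun_prop)
      (fun r y ↦ ((hf.differentiable two_ne_zero _).hasFDerivAt).comp_hasDerivAt r (hline y r)) r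
  have hdφ₁ (r : ℝ) : HasDerivAt φ₁ (φ₂ r) r := by
    refine hasDerivAt_integral_of_compactSpace
      (F := fun r (y : Metric.sphere (0 : EuclideanSpace ℝ (Fin (n + 1))) 1) ↦
        fderiv ℝ f (x + r • (y : _)) y)
      (F' := fun r y ↦ fderiv ℝ (fderiv ℝ f) (x + r • (y : _)) y y)
      (by simp only [Function.uncurry_def]; fun_prop)
      (by simp only [Function.uncurry_def]; fun_prop) (fun r y ↦ ?_) r
    simpa using (((hD.differentiable one_ne_zero _).hasFDerivAt).comp_hasDerivAt r
      (hline y r)).clm_apply (hasDerivAt_const r (y : EuclideanSpace ℝ (Fin (n + 1))))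
  have hφ₁0 : φ₁ 0 = 0 := by
    have := integral_toSphere_comp_linearIsometryEquiv
      (LinearIsometryEquiv.neg ℝ (E := EuclideanSpace ℝ (Fin (n + 1)))) (fderiv ℝ f x).continuous
    simp only [LinearIsometryEquiv.coe_neg, map_neg, integral_neg] at this
    simp only [hφ₁, zero_smul, add_zero]
    linarith
  have hφ₂le (r : ℝ) (hr : 0 < r) : r * φ₂ r + n * φ₁ r ≤ r * (ℓ * c) := by
    have h := integral_toSphere_laplacian hf x r
    have hle : ∫ y : Metric.sphere (0 : EuclideanSpace ℝ (Fin (n + 1))) 1,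
        (hessianMatrix f (x + r • (y : EuclideanSpace ℝ (Fin (n + 1))))).trace ∂σ ≤ ℓ * c := by
      have hi : Integrable (fun y : Metric.sphere (0 : EuclideanSpace ℝ (Fin (n + 1))) 1 ↦
          (hessianMatrix f (x + r • (y : EuclideanSpace ℝ (Fin (n + 1))))).trace) σ := by
        refine Continuous.integrable_of_hasCompactSupport ?_ (.of_compactSpace _)
        simp only [hessianMatrix, Matrix.trace, Matrix.diag, Matrix.of_apply,
          iteratedFDeriv_two_apply]
        fun_prop
      refine (integral_mono hi (integrable_const ℓ) fun y ↦ hΔf _).trans_eq ?_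
      simp [hc, mul_comm]
    push_cast at h
    rw [add_sub_cancel_right] at h
    exact h.symm.trans_le (by gcongr)
  have hdk (r : ℝ) : HasDerivAt (fun r ↦ r ^ n * (φ₁ r - ℓ * c / (n + 1) * r))
      (n * r ^ (n - 1) * (φ₁ r - ℓ * c / (n + 1) * r) + r ^ n * (φ₂ r - ℓ * c / (n + 1))) r := by
    have := (hasDerivAt_pow n r).mul
      ((hdφ₁ r).sub ((hasDerivAt_id r).const_mul (ℓ * c / (n + 1))))
    simpa [Pi.mul_def, Pi.sub_def] using this
  have hk : AntitoneOn (fun r ↦ r ^ n * (φ₁ r - ℓ * c / (n + 1) * r)) (Set.Ici 0) := by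
    refine antitoneOn_of_deriv_nonpos (convex_Ici 0)
      (fun r _ ↦ (hdk r).continuousAt.continuousWithinAt)
      (fun r _ ↦ (hdk r).differentiableAt.differentiableWithinAt) fun r hr ↦ ?_
    rw [interior_Ici, Set.mem_Ioi] at hr
    rw [(hdk r).deriv]
    refine nonpos_of_mul_nonpos_right ?_ hr
    have hn : (n : ℝ) * r ^ (n - 1) * r = n * r ^ n := by
      cases n with
      | zero => simp
      | succ m => simp [pow_succ, mul_assoc]
    calc r * (n * r ^ (n - 1) * (φ₁ r - ℓ * c / (n + 1) * r) + r ^ n * (φ₂ r - ℓ * c / (n + 1)))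
        = r ^ n * (r * φ₂ r + n * φ₁ r - r * (ℓ * c)) := by
          have : ℓ * c / (n + 1 : ℝ) * (n + 1) = ℓ * c := by field_simp
          linear_combination (φ₁ r - ℓ * c / (n + 1) * r) * hn - r ^ n * r * this
      _ ≤ 0 := mul_nonpos_of_nonneg_of_nonpos (by positivity) (by linarith [hφ₂le r hr])
  have hφ₁le (r : ℝ) (hr : 0 < r) : φ₁ r ≤ ℓ * c / (n + 1) * r := by
    have := hk Set.self_mem_Ici (Set.mem_Ici.2 hr.le) hr.le
    simp only [hφ₁0, mul_zero, sub_zero] at this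
    exact sub_nonpos.1 (nonpos_of_mul_nonpos_right this (by positivity))
  have hdm (r : ℝ) : HasDerivAt (fun r ↦ φ r - ℓ * c / (n + 1) * (r ^ 2 / 2))
      (φ₁ r - ℓ * c / (n + 1) * r) r := by
    convert! (hdφ r).sub ((((hasDerivAt_pow 2 r).div_const 2)).const_mul (ℓ * c / (n + 1))) using 1
    simp
  have hm : AntitoneOn (fun r ↦ φ r - ℓ * c / (n + 1) * (r ^ 2 / 2)) (Set.Ici 0) := by
    refine antitoneOn_of_deriv_nonpos (convex_Ici 0)
      (fun r _ ↦ (hdm r).continuousAt.continuousWithinAt)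
      (fun r _ ↦ (hdm r).differentiableAt.differentiableWithinAt) fun r hr ↦ ?_
    rw [interior_Ici, Set.mem_Ioi] at hr
    rw [(hdm r).deriv]
    linarith [hφ₁le r hr]
  have hfin := hm Set.self_mem_Ici (Set.mem_Ici.2 hε.le) hε.le
  have hφ0 : φ 0 = c * f x := by simp [hφ, hc]
  have hφε : deltaEps f ε x = c⁻¹ * (φ ε - c * f x) := by
    rw [deltaEps, average_eq, smul_eq_mul, integral_sub _ (integrable_const _)]
    · simp [hφ, hc, hσ]
    · exact Continuous.integrable_of_hasCompactSupport (by fun_prop) (.of_compactSpace _)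
  simp only [hφ0] at hfin
  rw [hφε, inv_mul_le_iff₀ hc0]
  push_cast
  have : c * (ℓ / (n + 1) * (ε ^ 2 / 2)) = ℓ * c / (n + 1) * (ε ^ 2 / 2) := by ring
  rw [this]
  norm_num at hfin
  linarith
end

section
/- Let d ≥ 1, let H be a d×d real symmetric matrix and X a d×d real symmetric positive definite matrix. Then Tr(H X H) · Tr(X⁻¹) ≥ (Tr H)². -/
open Matrix

/-- Cauchy–Schwarz for the Frobenius inner product:
`Tr(HXH) · Tr(X⁻¹) ≥ (Tr H)²` for symmetric `H` and positive definite `X`. -/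
theorem trace_cauchy_schwarz {d : ℕ} (hd : 1 ≤ d)
    (H X : Matrix (Fin d) (Fin d) ℝ) (hH : H.IsSymm) (hX : X.PosDef) :
    (H.trace) ^ 2 ≤ (H * X * H).trace * (X⁻¹).trace := by
  have hdet : IsUnit X.det := hX.det_pos.ne'.isUnit
  have hXT : Xᵀ = X := (conjTranspose_eq_transpose_of_trivial X).symm.trans hX.isHermitian
  have quadratic_nonneg (t : ℝ) :
      0 ≤ (H * X * H).trace * (t * t) + 2 * H.trace * t + (X⁻¹).trace := by
    have h := (hX.inv.posSemidef.conjTranspose_mul_mul_same (t • (X * H) + 1)).trace_nonneg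
    have expand : (t • (X * H) + 1)ᴴ * X⁻¹ * (t • (X * H) + 1) =
        (t * t) • (H * X * H) + (2 * t) • H + X⁻¹ := by
      have hleft : (t • (X * H) + 1)ᴴ * X⁻¹ = t • H + X⁻¹ := by
        simp [hXT, hH.eq, add_mul, mul_nonsing_inv_cancel_right _ _ hdet]
      rw [hleft, add_mul, mul_add, mul_add, mul_one, mul_one, mul_smul_comm, mul_smul_comm,
        nonsing_inv_mul_cancel_left _ _ hdet, smul_mul_assoc, smul_smul, ← mul_assoc, two_mul,
        add_smul]
      abel
    rw [expand] at h
    simp only [trace_add, trace_smul, smul_eq_mul] at h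
    linarith
  have hdiscrim := discrim_le_zero quadratic_nonneg
  rw [discrim] at hdiscrim
  linarith
end

section
/- Let d ≥ 1 and let f : 𝕊_d → ℝ be a good function. Then there exists a positive definite matrix E ∈ 𝕊_d with E ∈ ∂f(0), i.e. f(Z) ≥ ⟨Z, E⟩ for all Z ∈ 𝕊_d. -/
open Matrix

/-- The Frobenius inner product `⟨A, B⟩ = Tr(Bᵀ A)`. -/
def frob {d : ℕ} (A B : Matrix (Fin d) (Fin d) ℝ) : ℝ := (Bᵀ * A).trace

lemma Matrix.PosSemidef.isSymm {d : ℕ} {P : Matrix (Fin d) (Fin d) ℝ} (hP : P.PosSemidef) :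
    P.IsSymm := by
  simpa [Matrix.IsSymm, Matrix.IsHermitian] using hP.isHermitian

lemma isClosed_setOf_posSemidef (d : ℕ) :
    IsClosed {P : Matrix (Fin d) (Fin d) ℝ | P.PosSemidef} := by
  simp only [posSemidef_iff_dotProduct_mulVec, Set.ofPred_and, Set.ofPred_forall]
  refine IsClosed.inter ?_ (isClosed_iInter fun x => ?_)
  · exact isClosed_eq (by fun_prop) continuous_id
  · exact isClosed_le continuous_const (by fun_prop)

/-- A continuous, positively homogeneous function which is positive on nonzero positive
semidefinite matrices dominates a positive multiple of the trace on the semidefinite cone. -/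
lemma exists_pos_mul_trace_le {d : ℕ} (hd : 1 ≤ d) (f : Matrix (Fin d) (Fin d) ℝ → ℝ)
    (hf_cont : Continuous f)
    (hf_pos : ∀ X : Matrix (Fin d) (Fin d) ℝ, X.PosSemidef → X ≠ 0 → 0 < f X)
    (hf_zero : f 0 = 0)
    (hf_hom : ∀ t : ℝ, 0 < t → ∀ X : Matrix (Fin d) (Fin d) ℝ, X.IsSymm →
      f (t • X) = t * f X) :
    ∃ ε : ℝ, 0 < ε ∧ ∀ P : Matrix (Fin d) (Fin d) ℝ, P.PosSemidef → ε * P.trace ≤ f P := by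
  let : NormedAddCommGroup (Matrix (Fin d) (Fin d) ℝ) := Matrix.normedAddCommGroup
  let : NormedSpace ℝ (Matrix (Fin d) (Fin d) ℝ) := Matrix.normedSpace
  have : ProperSpace (Matrix (Fin d) (Fin d) ℝ) := FiniteDimensional.proper ℝ _
  obtain ⟨c, hc, hcf⟩ : ∃ c : ℝ, 0 < c ∧ ∀ P : Matrix (Fin d) (Fin d) ℝ, P.PosSemidef →
      ‖P‖ = 1 → c ≤ f P := by
    have hK : IsCompact (Metric.sphere (0 : Matrix (Fin d) (Fin d) ℝ) 1 ∩ {P | P.PosSemidef}) :=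
      (isCompact_sphere _ _).inter_right (isClosed_setOf_posSemidef d)
    obtain ⟨c, hc, h⟩ := hK.exists_forall_le' (a := 0) hf_cont.continuousOn fun P hP =>
      hf_pos P hP.2 fun h0 => by simp [h0] at hP
    exact ⟨c, hc, fun P hP hn => h P ⟨by simpa using hn, hP⟩⟩
  have hd0 : (0 : ℝ) < d := by exact_mod_cast hd
  refine ⟨c / d, by positivity, fun P hP => ?_⟩
  have htr : P.trace ≤ d * ‖P‖ := by
    have : ∑ i, P i i ≤ ∑ _i : Fin d, ‖P‖ :=
      Finset.sum_le_sum fun i _ => (le_abs_self _).trans (Matrix.norm_entry_le_entrywise_sup_norm P)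
    simpa [Matrix.trace] using this
  rcases eq_or_ne P 0 with rfl | hP0
  · simp [hf_zero]
  have hn : 0 < ‖P‖ := norm_pos_iff.mpr hP0
  have h1 := hcf (‖P‖⁻¹ • P) (hP.smul (by positivity)) (by
    rw [norm_smul, norm_inv, norm_norm, inv_mul_cancel₀ hn.ne'])
  rw [hf_hom _ (by positivity) _ hP.isSymm, inv_mul_eq_div, le_div_iff₀ hn] at h1
  calc c / d * P.trace ≤ c / d * (d * ‖P‖) := by gcongr
    _ = c * ‖P‖ := by field_simp
    _ ≤ f P := h1

/-- A linear functional is represented on symmetric matrices by a symmetric matrix. -/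
lemma exists_isSymm_frob_eq {d : ℕ} (ψ : Matrix (Fin d) (Fin d) ℝ →ₗ[ℝ] ℝ) :
    ∃ E : Matrix (Fin d) (Fin d) ℝ, E.IsSymm ∧
      ∀ Z : Matrix (Fin d) (Fin d) ℝ, Z.IsSymm → frob Z E = ψ Z := by
  have hψ (Z : Matrix (Fin d) (Fin d) ℝ) : ψ Z = ∑ i, ∑ j, Z i j * ψ (single i j 1) := by
    conv_lhs => rw [matrix_eq_sum_single Z]
    simp only [map_sum]
    refine Finset.sum_congr rfl fun i _ => Finset.sum_congr rfl fun j _ => ?_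
    rw [← smul_eq_mul, ← map_smul, smul_single, smul_eq_mul, mul_one]
  refine ⟨of fun i j => (ψ (single i j 1) + ψ (single j i 1)) / 2, ?_, fun Z hZ => ?_⟩
  · ext i j
    simp [add_comm]
  · have h2 : ψ Z = ∑ i, ∑ j, Z i j * ψ (single j i 1) := by
      rw [hψ, Finset.sum_comm]
      exact Finset.sum_congr rfl fun i _ => Finset.sum_congr rfl fun j _ => by rw [hZ.apply]
    have h3 : frob Z (of fun i j => (ψ (single i j 1) + ψ (single j i 1)) / 2) =
        ((∑ i, ∑ j, Z i j * ψ (single i j 1)) + ∑ i, ∑ j, Z i j * ψ (single j i 1)) / 2 := by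
      rw [frob, trace, ← Finset.sum_add_distrib, Finset.sum_div]
      simp only [diag_apply, mul_apply, transpose_apply, of_apply]
      rw [Finset.sum_comm]
      refine Finset.sum_congr rfl fun i _ => ?_
      rw [← Finset.sum_add_distrib, Finset.sum_div]
      exact Finset.sum_congr rfl fun j _ => by ring
    rw [h3, ← hψ, ← h2]
    ring

/-- For a good function `f` on symmetric matrices, there exists a positive
definite matrix `E ∈ ∂f(0)`, i.e. `f(Z) ≥ ⟨Z, E⟩` for all symmetric `Z`. -/
theorem exists_posDef_subgradient_at_zero {d : ℕ} (hd : 1 ≤ d)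
    (f : Matrix (Fin d) (Fin d) ℝ → ℝ)
    (hf_cont : Continuous f)
    (hf_convex : ConvexOn ℝ {A : Matrix (Fin d) (Fin d) ℝ | A.IsSymm} f)
    (hf_mono : ∀ X X' : Matrix (Fin d) (Fin d) ℝ,
      X.PosSemidef → (X' - X).PosSemidef → f X ≤ f X')
    (hf_pos : ∀ X : Matrix (Fin d) (Fin d) ℝ, X.PosSemidef → X ≠ 0 → 0 < f X)
    (hf_hom : ∀ t : ℝ, 0 < t → ∀ X : Matrix (Fin d) (Fin d) ℝ, X.IsSymm →
      f (t • X) = t * f X) :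
    ∃ E : Matrix (Fin d) (Fin d) ℝ, E.PosDef ∧
      ∀ Z : Matrix (Fin d) (Fin d) ℝ, Z.IsSymm → frob Z E ≤ f Z := by
  have hf_zero : f 0 = 0 := by
    have h := hf_hom 2 two_pos 0 isSymm_zero
    rw [smul_zero] at h
    linarith
  obtain ⟨ε, hε, hεf⟩ := exists_pos_mul_trace_le hd f hf_cont hf_pos hf_zero hf_hom
  let S : Matrix (Fin d) (Fin d) ℝ →ₗ[ℝ] Matrix (Fin d) (Fin d) ℝ :=
    (1 / 2 : ℝ) • (LinearMap.id + (transposeLinearEquiv (Fin d) (Fin d) ℝ ℝ).toLinearMap)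
  have hS (Z) : S Z = (1 / 2 : ℝ) • (Z + Zᵀ) := rfl
  have hS_symm (Z) : (S Z).IsSymm := by
    rw [hS]
    exact (isSymm_add_transpose_self Z).smul _
  have hS_eq {Z : Matrix (Fin d) (Fin d) ℝ} (hZ : Z.IsSymm) : S Z = Z := by
    rw [hS, hZ.eq, ← two_smul ℝ Z, smul_smul]
    norm_num
  have hS_cont : Continuous S := by
    simp only [show ⇑S = fun Z => (1 / 2 : ℝ) • (Z + Zᵀ) from rfl]
    fun_prop
  let A : Set (Matrix (Fin d) (Fin d) ℝ × ℝ) := {p | f (S p.1) < p.2}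
  let B : Set (Matrix (Fin d) (Fin d) ℝ × ℝ) := {p | p.1.PosSemidef ∧ p.2 ≤ ε * p.1.trace}
  have hA_open : IsOpen A := isOpen_lt (by fun_prop) continuous_snd
  have hA_convex : Convex ℝ A := by
    rintro p hp q hq a b ha hb hab
    have h := hf_convex.2 (hS_symm p.1) (hS_symm q.1) ha hb hab
    simp only [A, Set.mem_ofPred_eq, Prod.fst_add, Prod.snd_add, Prod.smul_fst, Prod.smul_snd,
      map_add, map_smul, smul_eq_mul] at hp hq h ⊢
    rcases ha.eq_or_lt with rfl | ha'
    · obtain rfl : b = 1 := by linarith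
      linarith
    · nlinarith [mul_lt_mul_of_pos_left hp ha', mul_le_mul_of_nonneg_left hq.le hb]
  have hB_convex : Convex ℝ B := by
    rintro p ⟨hp, hp'⟩ q ⟨hq, hq'⟩ a b ha hb hab
    refine ⟨(hp.smul ha).add (hq.smul hb), ?_⟩
    simp only [Prod.fst_add, Prod.snd_add, Prod.smul_fst, Prod.smul_snd, trace_add, trace_smul,
      smul_eq_mul]
    nlinarith [mul_le_mul_of_nonneg_left hp' ha, mul_le_mul_of_nonneg_left hq' hb]
  have hAB : Disjoint A B := by
    rw [Set.disjoint_left]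
    rintro p hp ⟨hq, hq'⟩
    simp only [A, Set.mem_ofPred_eq, hS_eq hq.isSymm] at hp
    linarith [hεf p.1 hq]
  obtain ⟨φ, u, hφA, hφB⟩ := geometric_hahn_banach_open hA_convex hA_open hB_convex hAB
  have hu : u ≤ 0 := by
    simpa using hφB 0 ⟨PosSemidef.zero, by simp⟩
  let c : ℝ := -φ (0, 1)
  have hφ (Z : Matrix (Fin d) (Fin d) ℝ) (r : ℝ) : φ (Z, r) = φ (Z, 0) - c * r := by
    have : (Z, r) = (Z, 0) + r • ((0, 1) : Matrix (Fin d) (Fin d) ℝ × ℝ) := by simp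
    rw [this, map_add, map_smul, smul_eq_mul]
    ring
  have hφ0 : φ (0, 0) = 0 := map_zero φ
  have hA0 (δ : ℝ) (hδ : 0 < δ) : -(c * δ) < u := by
    have h := hφA (0, δ) (by simpa [A, hf_zero] using hδ)
    rwa [hφ, hφ0, zero_sub] at h
  have hc : 0 < c := by linarith [hA0 1 one_pos]
  have hu0 : 0 ≤ u := by
    by_contra! hlt
    have h := hA0 (-u / c) (div_pos (by linarith) hc)
    rw [mul_div_cancel₀ _ hc.ne'] at h
    linarith
  obtain ⟨E, hE, hEψ⟩ := exists_isSymm_frob_eq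
    (c⁻¹ • φ.toLinearMap ∘ₗ LinearMap.inl ℝ (Matrix (Fin d) (Fin d) ℝ) ℝ)
  replace hEψ (Z : Matrix (Fin d) (Fin d) ℝ) (hZ : Z.IsSymm) : frob Z E = c⁻¹ * φ (Z, 0) :=
    hEψ Z hZ
  refine ⟨E, ?_, fun Z hZ => ?_⟩
  · refine PosDef.of_dotProduct_mulVec_pos hE fun x hx => ?_
    have hP : (vecMulVec x x).PosSemidef := by simpa using posSemidef_vecMulVec_self_star x
    have hB := hφB (vecMulVec x x, ε * (vecMulVec x x).trace) ⟨hP, le_rfl⟩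
    rw [hφ, trace_vecMulVec] at hB
    have hxx : 0 < x ⬝ᵥ x := by simpa using dotProduct_star_self_pos_iff.mpr hx
    have hfrob : star x ⬝ᵥ E *ᵥ x = frob (vecMulVec x x) E := by
      rw [frob, hE.eq, mul_vecMulVec, trace_vecMulVec, dotProduct_comm, star_trivial]
    rw [hfrob, hEψ _ hP.isSymm]
    have : 0 < c * (ε * (x ⬝ᵥ x)) := by positivity
    exact mul_pos (inv_pos.mpr hc) (by linarith)
  · rw [hEψ Z hZ, inv_mul_le_iff₀ hc]
    refine le_of_forall_pos_le_add fun δ hδ => ?_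
    have h := hφA (Z, f Z + δ / c) (by simpa [A, hS_eq hZ] using div_pos hδ hc)
    rw [hφ, mul_add, mul_div_cancel₀ _ hc.ne'] at h
    linarith
end

section
/- Let d ≥ 1. Let η : ℝ^d → [0,∞) be a continuous compactly supported function with ∫_{ℝ^d} η(z) dz = 1, and let M : ℝ^d → 𝕊_d be a continuous map such that M(x) is positive definite for every x. Then for every x ∈ ℝ^d, the matrix (M ∗ η)(x) := ∫_{ℝ^d} M(x − z) η(z) dz is positive definite and satisfies ((M ∗ η)(x))⁻¹ ⪯ (M⁻¹ ∗ η)(x), where (M⁻¹ ∗ η)(x) := ∫_{ℝ^d} M(x − z)⁻¹ η(z) dz. -/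
open MeasureTheory Matrix

/-- Entrywise convolution of a matrix-valued map with a kernel `η`. -/
noncomputable def matConv {d : ℕ} (M : EuclideanSpace ℝ (Fin d) → Matrix (Fin d) (Fin d) ℝ)
    (η : EuclideanSpace ℝ (Fin d) → ℝ) (x : EuclideanSpace ℝ (Fin d)) :
    Matrix (Fin d) (Fin d) ℝ :=
  Matrix.of fun i j => ∫ z, M (x - z) i j * η z

theorem continuous_matrix_inv_apply {X n : Type*} [TopologicalSpace X] [Fintype n] [DecidableEq n]
    {M : X → Matrix n n ℝ} (hM : ∀ i j, Continuous fun x => M x i j)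
    (hdet : ∀ x, (M x).det ≠ 0) (i j : n) : Continuous fun x => (M x)⁻¹ i j := by
  have hc : Continuous M := continuous_matrix hM
  simp only [Matrix.inv_def, Ring.inverse_eq_inv', Matrix.smul_apply, smul_eq_mul]
  exact (hc.matrix_det.inv₀ hdet).mul (hc.matrix_adjugate.matrix_elem i j)

theorem Matrix.PosDef.two_mul_dotProduct_sub_le {n : Type*} [Fintype n] [DecidableEq n]
    {A : Matrix n n ℝ} (hA : A.PosDef) (u v : n → ℝ) :
    2 * (u ⬝ᵥ v) - u ⬝ᵥ (A *ᵥ u) ≤ v ⬝ᵥ (A⁻¹ *ᵥ v) := by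
  have hdet : IsUnit A.det := A.isUnit_iff_isUnit_det.mp hA.isUnit
  have hT : Aᵀ = A := by simpa using hA.isHermitian.eq
  have h := hA.inv.posSemidef.dotProduct_mulVec_nonneg (v - A *ᵥ u)
  have h1 : A⁻¹ *ᵥ (A *ᵥ u) = u := by
    rw [mulVec_mulVec, nonsing_inv_mul _ hdet, one_mulVec]
  have h2 : (A *ᵥ u) ⬝ᵥ (A⁻¹ *ᵥ v) = u ⬝ᵥ v := by
    rw [← vecMul_transpose, hT, ← dotProduct_mulVec, mulVec_mulVec, mul_nonsing_inv _ hdet,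
      one_mulVec]
  simp only [star_trivial, mulVec_sub, sub_dotProduct, dotProduct_sub, h1, h2] at h
  rw [dotProduct_comm v u, dotProduct_comm (A *ᵥ u) u] at h
  linarith

section Convolution

variable {d : ℕ} {η : EuclideanSpace ℝ (Fin d) → ℝ}
  {M : EuclideanSpace ℝ (Fin d) → Matrix (Fin d) (Fin d) ℝ}

theorem continuous_dotProduct_mulVec_mul (hη : Continuous η)
    (hM : ∀ i j, Continuous fun x => M x i j) (x : EuclideanSpace ℝ (Fin d)) (v : Fin d → ℝ) :
    Continuous fun z => (v ⬝ᵥ (M (x - z) *ᵥ v)) * η z := by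
  have hc : Continuous M := continuous_matrix hM
  fun_prop

theorem integrable_dotProduct_mulVec_mul (hη : Continuous η) (hη_supp : HasCompactSupport η)
    (hM : ∀ i j, Continuous fun x => M x i j) (x : EuclideanSpace ℝ (Fin d)) (v : Fin d → ℝ) :
    Integrable fun z => (v ⬝ᵥ (M (x - z) *ᵥ v)) * η z :=
  (continuous_dotProduct_mulVec_mul hη hM x v).integrable_of_hasCompactSupport hη_supp.mul_left

theorem dotProduct_matConv_mulVec (hη : Continuous η) (hη_supp : HasCompactSupport η)
    (hM : ∀ i j, Continuous fun x => M x i j) (x : EuclideanSpace ℝ (Fin d)) (v : Fin d → ℝ) :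
    v ⬝ᵥ (matConv M η x *ᵥ v) = ∫ z, (v ⬝ᵥ (M (x - z) *ᵥ v)) * η z := by
  have hint : ∀ i j, Integrable fun z => v i * ((M (x - z) i j * η z) * v j) := fun i j =>
    ((((hM i j).comp (continuous_const.sub continuous_id)).mul hη).integrable_of_hasCompactSupport
      hη_supp.mul_left |>.mul_const _).const_mul _
  have hsum : ∀ z, (v ⬝ᵥ (M (x - z) *ᵥ v)) * η z =
      ∑ i, ∑ j, v i * ((M (x - z) i j * η z) * v j) := fun z => by
    simp only [dotProduct, mulVec, Finset.sum_mul, Finset.mul_sum]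
    exact Finset.sum_congr rfl fun i _ => Finset.sum_congr rfl fun j _ => by ring
  simp only [hsum]
  rw [integral_finsetSum _ fun i _ => integrable_finsetSum _ fun j _ => hint i j]
  simp only [dotProduct, mulVec, matConv, of_apply, Finset.mul_sum]
  refine Finset.sum_congr rfl fun i _ => ?_
  rw [integral_finsetSum _ fun j _ => hint i j]
  simp only [integral_const_mul, integral_mul_const]

theorem isHermitian_matConv (hM : ∀ x, (M x).IsHermitian) (x : EuclideanSpace ℝ (Fin d)) :
    (matConv M η x).IsHermitian := by
  ext i j
  have h : ∀ y, M y j i = M y i j := fun y => by simpa using (hM y).apply i j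
  simp [matConv, h]

theorem posDef_matConv (hη : Continuous η) (hη_nonneg : ∀ z, 0 ≤ η z)
    (hη_supp : HasCompactSupport η) (hη_ne : η ≠ 0) (hM : ∀ i j, Continuous fun x => M x i j)
    (hM_pos : ∀ x, (M x).PosDef) (x : EuclideanSpace ℝ (Fin d)) : (matConv M η x).PosDef := by
  refine .of_dotProduct_mulVec_pos (isHermitian_matConv (fun y => (hM_pos y).isHermitian) x)
    fun v hv => ?_
  have hpos : ∀ y, 0 < v ⬝ᵥ (M y *ᵥ v) := fun y => by
    simpa using (hM_pos y).dotProduct_mulVec_pos hv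
  obtain ⟨z, hz⟩ := Function.ne_iff.mp hη_ne
  rw [star_trivial, dotProduct_matConv_mulVec hη hη_supp hM]
  exact (continuous_dotProduct_mulVec_mul hη hM x v).integral_pos_of_hasCompactSupport_nonneg_nonzero
    hη_supp.mul_left (fun z => mul_nonneg (hpos _).le (hη_nonneg z))
    (x := z) (mul_ne_zero (hpos _).ne' hz)

end Convolution

/-- For a continuous positive-definite-valued map `M` and a continuous compactly
supported probability kernel `η`, the convolution `(M ∗ η)(x)` is positive
definite and `((M ∗ η)(x))⁻¹ ⪯ (M⁻¹ ∗ η)(x)`. -/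
theorem conv_posDef_inv_le {d : ℕ} (hd : 1 ≤ d)
    (η : EuclideanSpace ℝ (Fin d) → ℝ)
    (hη_cont : Continuous η) (hη_nonneg : ∀ z, 0 ≤ η z)
    (hη_supp : HasCompactSupport η)
    (hη_int : ∫ z, η z = 1)
    (M : EuclideanSpace ℝ (Fin d) → Matrix (Fin d) (Fin d) ℝ)
    (hM_cont : ∀ i j, Continuous fun x => M x i j)
    (hM_pos : ∀ x, (M x).PosDef)
    (x : EuclideanSpace ℝ (Fin d)) :
    (matConv M η x).PosDef ∧
    (matConv (fun y => (M y)⁻¹) η x - (matConv M η x)⁻¹).PosSemidef := by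
  have hη_ne : η ≠ 0 := by
    rintro rfl
    simp at hη_int
  have hC := posDef_matConv hη_cont hη_nonneg hη_supp hη_ne hM_cont hM_pos x
  have hinv_cont := continuous_matrix_inv_apply hM_cont fun y => (hM_pos y).det_pos.ne'
  refine ⟨hC, .of_dotProduct_mulVec_nonneg
    ((isHermitian_matConv (fun y => (hM_pos y).inv.isHermitian) x).sub hC.inv.isHermitian)
    fun v => ?_⟩
  set u := (matConv M η x)⁻¹ *ᵥ v with hu
  have hCu : matConv M η x *ᵥ u = v := by
    rw [hu, mulVec_mulVec, mul_nonsing_inv _ (isUnit_iff_ne_zero.mpr hC.det_pos.ne'), one_mulVec]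
  have hη_integrable := hη_cont.integrable_of_hasCompactSupport (μ := volume) hη_supp
  have hM_integrable := integrable_dotProduct_mulVec_mul hη_cont hη_supp hM_cont x u
  have hle : ∫ z, (2 * (u ⬝ᵥ v) * η z - (u ⬝ᵥ (M (x - z) *ᵥ u)) * η z) ≤
      ∫ z, (v ⬝ᵥ ((M (x - z))⁻¹ *ᵥ v)) * η z :=
    integral_mono ((hη_integrable.const_mul _).sub hM_integrable)
      (integrable_dotProduct_mulVec_mul hη_cont hη_supp hinv_cont x v) fun z => by
        simpa only [sub_mul] using mul_le_mul_of_nonneg_right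
          ((hM_pos (x - z)).two_mul_dotProduct_sub_le u v) (hη_nonneg z)
  rw [integral_sub (hη_integrable.const_mul _) hM_integrable, integral_const_mul, hη_int,
    ← dotProduct_matConv_mulVec hη_cont hη_supp hM_cont,
    ← dotProduct_matConv_mulVec hη_cont hη_supp hinv_cont, hCu] at hle
  rw [star_trivial, sub_mulVec, dotProduct_sub, ← hu, dotProduct_comm v u]
  linarith
end

section
/- Let d ≥ 1, Λ > 0. Let V : ℝ^d → ℝ be smooth with e^{-V} Lebesgue-integrable on ℝ^d and with ΔV(x) ≤ Λ for every x ∈ ℝ^d, where ΔV is the trace of the Hessian of V. Let η : ℝ^d → [0,∞) be a smooth compactly supported function with ∫_{ℝ^d} η = 1, and assume e^{-V} ∗ η is everywhere strictly positive. Define V_η := −log(e^{-V} ∗ η). Then ΔV_η(x) ≤ Λ for every x ∈ ℝ^d. -/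
open MeasureTheory Matrix

section DirectionalDerivatives

variable {E : Type*} [NormedAddCommGroup E] [NormedSpace ℝ E]

theorem iteratedFDeriv_two_diag_eq_fderiv_fderiv_apply {f : E → ℝ} (hf : ContDiff ℝ 2 f)
    (x v : E) :
    iteratedFDeriv ℝ 2 f x ![v, v] = fderiv ℝ (fun y => fderiv ℝ f y v) x v := by
  have h1 : DifferentiableAt ℝ (fderiv ℝ f) x :=
    (hf.fderiv_right (m := 1) (by norm_num)).differentiable one_ne_zero x
  rw [iteratedFDeriv_two_apply, fderiv_clm_apply h1 (differentiableAt_const v)]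
  simp

theorem fderiv_exp_neg_apply {f : E → ℝ} (hf : Differentiable ℝ f) (x v : E) :
    fderiv ℝ (fun y => Real.exp (-f y)) x v = -fderiv ℝ f x v * Real.exp (-f x) := by
  have h : HasFDerivAt (fun y => Real.exp (-f y)) (Real.exp (-f x) • -fderiv ℝ f x) x :=
    ((hf x).hasFDerivAt.neg).exp
  rw [h.fderiv]
  simp [mul_comm]

theorem fderiv_fderiv_exp_neg_apply {f : E → ℝ} (hf : ContDiff ℝ 2 f) (x v : E) :
    fderiv ℝ (fun y => fderiv ℝ (fun y => Real.exp (-f y)) y v) x v =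
      ((fderiv ℝ f x v) ^ 2 - fderiv ℝ (fun y => fderiv ℝ f y v) x v) * Real.exp (-f x) := by
  have hd : Differentiable ℝ f := hf.differentiable two_ne_zero
  have h1 : Differentiable ℝ (fun y => fderiv ℝ f y v) :=
    ((hf.fderiv_right (m := 1) (by norm_num)).clm_apply contDiff_const).differentiable one_ne_zero
  simp_rw [fderiv_exp_neg_apply hd]
  have h : HasFDerivAt (fun y => -fderiv ℝ f y v * Real.exp (-f y)) _ x :=
    (h1 x).hasFDerivAt.neg.mul ((hd x).hasFDerivAt.neg).exp
  rw [h.fderiv]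
  simp only [_root_.add_apply, _root_.smul_apply, _root_.neg_apply, Pi.neg_apply, smul_eq_mul]
  ring

end DirectionalDerivatives

section Mollification

variable {E : Type*} [NormedAddCommGroup E] [MeasurableSpace E] [BorelSpace E]
  {μ : Measure E} {η : E → ℝ}

theorem integrable_comp_sub_mul [IsFiniteMeasureOnCompacts μ] {f : E → ℝ} (hf : Continuous f)
    (hη : Continuous η) (hη_supp : HasCompactSupport η) (x : E) :
    Integrable (fun z => f (x - z) * η z) μ :=
  Continuous.integrable_of_hasCompactSupport (by fun_prop) hη_supp.mul_left

variable [NormedSpace ℝ E]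

theorem hasDerivAt_integral_comp_sub_mul [IsFiniteMeasureOnCompacts μ] {f : E → ℝ}
    (hf : ContDiff ℝ 1 f) (hη : Continuous η) (hη_supp : HasCompactSupport η) (x v : E) :
    HasDerivAt (fun t : ℝ => ∫ z, f (x + t • v - z) * η z ∂μ)
      (∫ z, fderiv ℝ f (x - z) v * η z ∂μ) 0 := by
  have hfd : Continuous fun y => fderiv ℝ f y v :=
    (hf.continuous_fderiv one_ne_zero).clm_apply continuous_const
  obtain ⟨C, hC⟩ := ((isCompact_closedBall (0 : ℝ) 1).prod hη_supp).exists_bound_of_continuousOn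
    (f := fun p : ℝ × E => fderiv ℝ f (x + p.1 • v - p.2) v) (by fun_prop)
  have key := hasDerivAt_integral_of_dominated_loc_of_deriv_le (μ := μ) (x₀ := (0 : ℝ))
    (s := Metric.ball 0 1)
    (F := fun t z => f (x + t • v - z) * η z)
    (F' := fun t z => fderiv ℝ f (x + t • v - z) v * η z)
    (bound := fun z => C * ‖η z‖) (Metric.ball_mem_nhds 0 one_pos)
    (.of_forall fun t =>
      (integrable_comp_sub_mul hf.continuous hη hη_supp (x + t • v)).aestronglyMeasurable)
    (integrable_comp_sub_mul hf.continuous hη hη_supp (x + (0 : ℝ) • v))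
    (integrable_comp_sub_mul hfd hη hη_supp (x + (0 : ℝ) • v)).aestronglyMeasurable
    ?_ ((hη.integrable_of_hasCompactSupport hη_supp).norm.const_mul C) ?_
  · simpa using key.2
  · refine .of_forall fun z t ht => ?_
    rw [norm_mul]
    by_cases hz : z ∈ tsupport η
    · exact mul_le_mul_of_nonneg_right (hC (t, z) ⟨Metric.ball_subset_closedBall ht, hz⟩)
        (norm_nonneg _)
    · simp [image_eq_zero_of_notMem_tsupport hz]
  · refine .of_forall fun z t _ => ?_
    have h1 : HasDerivAt (fun t : ℝ => x + t • v - z) v t := by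
      simpa using (((hasDerivAt_id t).smul_const v).const_add x).sub_const z
    exact (((hf.differentiable one_ne_zero _).hasFDerivAt).comp_hasDerivAt t h1).mul_const (η z)

theorem contDiff_integral_comp_sub_mul [FiniteDimensional ℝ E] [μ.IsAddHaarMeasure]
    {n : ℕ∞} {f : E → ℝ} (hf : Continuous f)
    (hη : ContDiff ℝ n η) (hη_supp : HasCompactSupport η) :
    ContDiff ℝ n fun x => ∫ z, f (x - z) * η z ∂μ := by
  have h := hη_supp.contDiff_convolution_left (ContinuousLinearMap.mul ℝ ℝ) (μ := μ) hη
    hf.locallyIntegrable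
  convert h using 2 with x
  simp [convolution_def, mul_comm]

theorem fderiv_integral_comp_sub_mul_apply [FiniteDimensional ℝ E] [μ.IsAddHaarMeasure]
    {f : E → ℝ} (hf : ContDiff ℝ 1 f) (hη : ContDiff ℝ 1 η) (hη_supp : HasCompactSupport η)
    (x v : E) :
    fderiv ℝ (fun x => ∫ z, f (x - z) * η z ∂μ) x v = ∫ z, fderiv ℝ f (x - z) v * η z ∂μ := by
  have hd : DifferentiableAt ℝ (fun x => ∫ z, f (x - z) * η z ∂μ) x :=
    (contDiff_integral_comp_sub_mul (n := 1) hf.continuous hη hη_supp).differentiable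
      one_ne_zero x
  have h : HasLineDerivAt ℝ (fun x => ∫ z, f (x - z) * η z ∂μ) _ x v :=
    hasDerivAt_integral_comp_sub_mul hf hη.continuous hη_supp x v
  rw [← hd.lineDeriv_eq_fderiv, h.lineDeriv]

end Mollification

/-- The weighted Cauchy-Schwarz inequality, with the mean `A` of `a` under the weight `w`. -/
theorem sq_mul_integral_le_integral_sq_mul {α : Type*} [MeasurableSpace α] {μ : Measure α}
    {a w : α → ℝ} {A : ℝ} (hw : ∀ z, 0 ≤ w z) (hw_int : Integrable w μ)
    (ha : Integrable (fun z => a z * w z) μ) (ha2 : Integrable (fun z => a z ^ 2 * w z) μ)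
    (hA : ∫ z, a z * w z ∂μ = A * ∫ z, w z ∂μ) :
    A ^ 2 * ∫ z, w z ∂μ ≤ ∫ z, a z ^ 2 * w z ∂μ := by
  have h0 : 0 ≤ ∫ z, (a z - A) ^ 2 * w z ∂μ :=
    integral_nonneg fun z => mul_nonneg (sq_nonneg _) (hw z)
  have h1 : ∫ z, (a z - A) ^ 2 * w z ∂μ =
      ∫ z, a z ^ 2 * w z ∂μ - 2 * A * ∫ z, a z * w z ∂μ + A ^ 2 * ∫ z, w z ∂μ := by
    rw [← integral_const_mul, ← integral_const_mul, ← integral_sub ha2 (ha.const_mul _)]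
    refine Eq.trans ?_ (integral_add (ha2.sub (ha.const_mul (2 * A))) (hw_int.const_mul (A ^ 2)))
    exact integral_congr_ae (.of_forall fun z => by simp only; ring)
  rw [h1, hA] at h0
  linarith

theorem hessianMatrix_trace_eq_sum {d : ℕ} {f : EuclideanSpace ℝ (Fin d) → ℝ}
    (hf : ContDiff ℝ 2 f) (x : EuclideanSpace ℝ (Fin d)) :
    (hessianMatrix f x).trace = ∑ i, fderiv ℝ
      (fun y => fderiv ℝ f y (EuclideanSpace.single i 1)) x (EuclideanSpace.single i 1) := by
  simp only [Matrix.trace, Matrix.diag, hessianMatrix, Matrix.of_apply]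
  exact Finset.sum_congr rfl fun i _ => iteratedFDeriv_two_diag_eq_fderiv_fderiv_apply hf x _

/-- Mollification preserves the Laplacian bound: if `ΔV ≤ Λ`, then
`V_η := −log(e^{-V} ∗ η)` also satisfies `ΔV_η ≤ Λ`. -/
theorem laplacian_bound_of_mollified {d : ℕ} (hd : 1 ≤ d) (Λ : ℝ) (hΛ : 0 < Λ)
    (V : EuclideanSpace ℝ (Fin d) → ℝ) (hV : ContDiff ℝ (⊤ : ℕ∞) V)
    (hVint : Integrable (fun x => Real.exp (-V x)) volume)
    (hΔV : ∀ x, (hessianMatrix V x).trace ≤ Λ)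
    (η : EuclideanSpace ℝ (Fin d) → ℝ)
    (hη : ContDiff ℝ (⊤ : ℕ∞) η) (hη_nonneg : ∀ z, 0 ≤ η z)
    (hη_supp : HasCompactSupport η)
    (hη_int : ∫ z, η z = 1)
    (hpos : ∀ x : EuclideanSpace ℝ (Fin d),
      0 < ∫ z, Real.exp (-V (x - z)) * η z)
    (Vη : EuclideanSpace ℝ (Fin d) → ℝ)
    (hVη : ∀ x, Vη x = -Real.log (∫ z, Real.exp (-V (x - z)) * η z)) :
    ∀ x, (hessianMatrix Vη x).trace ≤ Λ := by
  intro x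
  have hV2 : ContDiff ℝ 2 V := contDiff_infty.1 hV 2
  have hη2 : ContDiff ℝ 2 η := contDiff_infty.1 hη 2
  have hη1 : ContDiff ℝ 1 η := hη2.of_le one_le_two
  have hηc := hη.continuous
  have hf2 : ContDiff ℝ 2 fun y => Real.exp (-V y) := hV2.neg.exp
  have hG2 : ContDiff ℝ 2 fun y => ∫ z, Real.exp (-V (y - z)) * η z :=
    contDiff_integral_comp_sub_mul (n := 2) hf2.continuous hη2 hη_supp
  have hVη2 : ContDiff ℝ 2 Vη := by
    rw [funext hVη]
    exact (hG2.log fun y => (hpos y).ne').neg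
  have hexp : (fun y => Real.exp (-Vη y)) = fun y => ∫ z, Real.exp (-V (y - z)) * η z := by
    funext y
    rw [hVη, neg_neg, Real.exp_log (hpos y)]
  have hG : Real.exp (-Vη x) = ∫ z, Real.exp (-V (x - z)) * η z := congrFun hexp x
  have hDV (v) : ContDiff ℝ 1 fun y => fderiv ℝ V y v :=
    (hV2.fderiv_right (m := 1) (by norm_num)).clm_apply contDiff_const
  have hDDV (v) : Continuous fun y => fderiv ℝ (fun y => fderiv ℝ V y v) y v :=
    ((hDV v).continuous_fderiv one_ne_zero).clm_apply continuous_const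
  have hDf (v) : ContDiff ℝ 1 fun y => fderiv ℝ (fun y => Real.exp (-V y)) y v :=
    (hf2.fderiv_right (m := 1) (by norm_num)).clm_apply contDiff_const
  have hint {a : EuclideanSpace ℝ (Fin d) → ℝ} (ha : Continuous a) :
      Integrable (fun z => a (x - z) * (Real.exp (-V (x - z)) * η z)) := by
    simpa only [Pi.mul_apply, mul_assoc] using
      integrable_comp_sub_mul (μ := volume) (ha.mul hf2.continuous) hηc hη_supp x
  have hw_int : Integrable fun z => Real.exp (-V (x - z)) * η z :=
    integrable_comp_sub_mul hf2.continuous hηc hη_supp x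
  have hw (z) : 0 ≤ Real.exp (-V (x - z)) * η z :=
    mul_nonneg (Real.exp_pos _).le (hη_nonneg z)
  have hdir (v) : fderiv ℝ (fun y => fderiv ℝ Vη y v) x v * Real.exp (-Vη x) ≤
      ∫ z, fderiv ℝ (fun y => fderiv ℝ V y v) (x - z) v * (Real.exp (-V (x - z)) * η z) := by
    have hDG (y) := fderiv_integral_comp_sub_mul_apply (μ := volume)
      (hf2.of_le one_le_two) hη1 hη_supp y v
    have hfirst := fderiv_exp_neg_apply (hVη2.differentiable two_ne_zero) x v
    have hsecond := fderiv_fderiv_exp_neg_apply hVη2 x v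
    rw [hexp] at hfirst hsecond
    simp_rw [hDG] at hfirst hsecond
    rw [fderiv_integral_comp_sub_mul_apply (hDf v) hη1 hη_supp] at hsecond
    simp_rw [fderiv_fderiv_exp_neg_apply hV2, mul_assoc, sub_mul] at hsecond
    have hsq : Integrable fun z =>
        fderiv ℝ V (x - z) v ^ 2 * (Real.exp (-V (x - z)) * η z) :=
      hint ((hDV v).continuous.pow 2)
    rw [integral_sub hsq (hint (hDDV v))] at hsecond
    simp_rw [fderiv_exp_neg_apply (hV2.differentiable two_ne_zero), neg_mul,
      mul_assoc] at hfirst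
    rw [integral_neg, neg_inj] at hfirst
    have hvar := sq_mul_integral_le_integral_sq_mul hw hw_int (hint (hDV v).continuous) hsq
      (hfirst.trans (by rw [hG]))
    rw [← hG] at hvar
    linarith
  refine le_of_mul_le_mul_right ?_ (Real.exp_pos (-Vη x))
  rw [hessianMatrix_trace_eq_sum hVη2, Finset.sum_mul]
  refine (Finset.sum_le_sum fun i _ => hdir _).trans ?_
  rw [← integral_finsetSum _ fun i _ => hint (hDDV _), hG, ← integral_const_mul]
  refine integral_mono (integrable_finsetSum _ fun i _ => hint (hDDV _)) (hw_int.const_mul _)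
    fun z => ?_
  simp only
  rw [← Finset.sum_mul, ← hessianMatrix_trace_eq_sum hV2]
  exact mul_le_mul_of_nonneg_right (hΔV _) (hw z)
end

section
/- Let d ≥ 1, let φ : ℝ^d → ℝ be four times continuously differentiable with Hessian H(x) := ∇²φ(x) positive definite for every x, and let W : ℝ^d → ℝ be twice continuously differentiable. Define V(x) := W(∇φ(x)) − log det(∇²φ(x)). Then for every x ∈ ℝ^d, ΔV(x) ≥ ⟨∇W(∇φ(x)), ∇(Δφ)(x)⟩ + Tr( H(x) · ∇²W(∇φ(x)) · H(x) ) − Tr( H(x)⁻¹ · ∇²(Δφ)(x) ), where Δφ(x) = Tr(∇²φ(x)), ∇(Δφ) and ∇²(Δφ) denote the gradient and Hessian of the function x ↦ Δφ(x), and ⟨·,·⟩ is the Euclidean inner product. -/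
open Matrix
open scoped RealInnerProductSpace

/-- The Laplacian of `f`, i.e. the trace of its Hessian. -/
noncomputable def laplacian {d : ℕ} (f : EuclideanSpace ℝ (Fin d) → ℝ)
    (x : EuclideanSpace ℝ (Fin d)) : ℝ :=
  (hessianMatrix f x).trace

/-- The partial derivative of `f` in the `i`-th coordinate direction. -/
noncomputable def partialDeriv {d : ℕ} (i : Fin d) (f : EuclideanSpace ℝ (Fin d) → ℝ)
    (x : EuclideanSpace ℝ (Fin d)) : ℝ :=
  fderiv ℝ f x (EuclideanSpace.single i (1 : ℝ))

section PartialDeriv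

variable {d : ℕ}

lemma ContDiff.partialDeriv {n m : WithTop ℕ∞} {f : EuclideanSpace ℝ (Fin d) → ℝ}
    (hf : ContDiff ℝ n f) (hmn : m + 1 ≤ n) (i : Fin d) :
    ContDiff ℝ m (partialDeriv i f) :=
  (hf.fderiv_right hmn).clm_apply contDiff_const

lemma hessianMatrix_apply {f : EuclideanSpace ℝ (Fin d) → ℝ} (hf : ContDiff ℝ 2 f)
    (x : EuclideanSpace ℝ (Fin d)) (i j : Fin d) :
    hessianMatrix f x i j = partialDeriv i (partialDeriv j f) x := by
  have h : DifferentiableAt ℝ (fderiv ℝ f) x :=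
    ((hf.fderiv_right (m := 1) (by norm_num)).differentiable (by norm_num)) x
  unfold partialDeriv
  rw [fderiv_clm_apply h (by fun_prop)]
  simp [hessianMatrix, iteratedFDeriv_two_apply]

lemma partialDeriv_comm {f : EuclideanSpace ℝ (Fin d) → ℝ} (hf : ContDiff ℝ 2 f) (i j : Fin d) :
    partialDeriv i (partialDeriv j f) = partialDeriv j (partialDeriv i f) := by
  funext x
  rw [← hessianMatrix_apply hf, ← hessianMatrix_apply hf]
  simp only [hessianMatrix, Matrix.of_apply, iteratedFDeriv_two_apply]
  exact (hf.contDiffAt.isSymmSndFDerivAt (by simp)) _ _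

lemma laplacian_eq_sum {f : EuclideanSpace ℝ (Fin d) → ℝ} (hf : ContDiff ℝ 2 f) :
    laplacian f = fun x => ∑ i, partialDeriv i (partialDeriv i f) x := by
  funext x
  simp [laplacian, Matrix.trace, hessianMatrix_apply hf]

lemma partialDeriv_sum {ι : Type*} [Fintype ι] {f : ι → EuclideanSpace ℝ (Fin d) → ℝ}
    (hf : ∀ k, Differentiable ℝ (f k)) (i : Fin d) :
    partialDeriv i (fun x => ∑ k, f k x) = fun x => ∑ k, partialDeriv i (f k) x := by
  funext x
  unfold partialDeriv
  rw [fderiv_fun_sum (fun k _ => hf k x)]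
  simp

lemma partialDeriv_mul {f g : EuclideanSpace ℝ (Fin d) → ℝ} (hf : Differentiable ℝ f)
    (hg : Differentiable ℝ g) (i : Fin d) :
    partialDeriv i (fun x => f x * g x) =
      fun x => partialDeriv i f x * g x + f x * partialDeriv i g x := by
  funext x
  unfold partialDeriv
  rw [fderiv_fun_mul (hf x) (hg x)]
  simp
  ring

lemma partialDeriv_const_mul {f : EuclideanSpace ℝ (Fin d) → ℝ} (hf : Differentiable ℝ f)
    (c : ℝ) (i : Fin d) :
    partialDeriv i (fun x => c * f x) = fun x => c * partialDeriv i f x := by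
  funext x
  unfold partialDeriv
  rw [fderiv_const_mul (hf x)]
  simp

lemma laplacian_sum_const_mul {ι : Type*} [Fintype ι] {f : ι → EuclideanSpace ℝ (Fin d) → ℝ}
    (hf : ∀ k, ContDiff ℝ 2 (f k)) (c : ι → ℝ) (x : EuclideanSpace ℝ (Fin d)) :
    laplacian (fun x => ∑ k, c k * f k x) x = ∑ k, c k * laplacian (f k) x := by
  have h1 : ∀ k, Differentiable ℝ (f k) := fun k => (hf k).differentiable (by norm_num)
  have h2 : ∀ i k, Differentiable ℝ (partialDeriv i (f k)) := fun i k =>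
    ((hf k).partialDeriv (m := 1) (by norm_num) i).differentiable (by norm_num)
  have key : ∀ i, partialDeriv i (partialDeriv i (fun x => ∑ k, c k * f k x)) x
      = ∑ k, c k * partialDeriv i (partialDeriv i (f k)) x := by
    intro i
    rw [partialDeriv_sum (fun k => (h1 k).const_mul (c k))]
    simp_rw [partialDeriv_const_mul (h1 _)]
    rw [partialDeriv_sum (fun k => (h2 i k).const_mul (c k))]
    simp_rw [partialDeriv_const_mul (h2 i _)]
  rw [laplacian_eq_sum (ContDiff.sum fun k _ => contDiff_const.mul (hf k))]
  simp_rw [key, laplacian_eq_sum (hf _), Finset.mul_sum]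
  exact Finset.sum_comm

lemma laplacian_add_sub {f g h : EuclideanSpace ℝ (Fin d) → ℝ} (hf : ContDiff ℝ 2 f)
    (hg : ContDiff ℝ 2 g) (hh : ContDiff ℝ 2 h) (x : EuclideanSpace ℝ (Fin d)) :
    laplacian (fun x => f x + g x - h x) x = laplacian f x + laplacian g x - laplacian h x := by
  have := laplacian_sum_const_mul (f := ![f, g, h])
    (by intro k; fin_cases k <;> assumption) ![1, 1, -1] x
  simpa [Fin.sum_univ_three, ← sub_eq_add_neg] using this

lemma partialDeriv_laplacian {f : EuclideanSpace ℝ (Fin d) → ℝ} (hf : ContDiff ℝ 3 f)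
    (i : Fin d) : partialDeriv i (laplacian f) = laplacian (partialDeriv i f) := by
  have hf2 : ContDiff ℝ 2 f := hf.of_le (by norm_num)
  have h2 : ∀ j, ContDiff ℝ 2 (partialDeriv j f) := fun j => hf.partialDeriv (by norm_num) j
  rw [laplacian_eq_sum hf2, laplacian_eq_sum (h2 i), partialDeriv_sum]
  · funext x
    refine Finset.sum_congr rfl fun j _ => ?_
    rw [partialDeriv_comm (h2 j), partialDeriv_comm hf2]
  · exact fun j => ((h2 j).partialDeriv (m := 1) (by norm_num) j).differentiable (by norm_num)

lemma gradient_apply (f : EuclideanSpace ℝ (Fin d) → ℝ) (x : EuclideanSpace ℝ (Fin d))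
    (j : Fin d) : gradient f x j = partialDeriv j f x := by
  have h := inner_gradient_left (𝕜 := ℝ) (f := f) (x := x)
    (y := EuclideanSpace.single j (1 : ℝ))
  rw [EuclideanSpace.inner_single_right] at h
  simpa [partialDeriv] using h

lemma contDiff_gradient {n m : WithTop ℕ∞} {f : EuclideanSpace ℝ (Fin d) → ℝ}
    (hf : ContDiff ℝ n f) (hmn : m + 1 ≤ n) : ContDiff ℝ m (gradient f) := by
  rw [contDiff_euclidean]
  intro i
  simp_rw [gradient_apply]
  exact hf.partialDeriv hmn i

lemma fderiv_apply_eq_sum (f : EuclideanSpace ℝ (Fin d) → ℝ) (x v : EuclideanSpace ℝ (Fin d)) :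
    fderiv ℝ f x v = ∑ j, partialDeriv j f x * v j := by
  rw [← inner_gradient_left (𝕜 := ℝ), PiLp.inner_apply]
  simp [gradient_apply, mul_comm]

lemma partialDeriv_comp_gradient {f φ : EuclideanSpace ℝ (Fin d) → ℝ}
    (hf : Differentiable ℝ f) (hφ : ContDiff ℝ 2 φ) (i : Fin d) :
    partialDeriv i (fun x => f (gradient φ x)) = fun x =>
      ∑ j, partialDeriv j f (gradient φ x) * partialDeriv i (partialDeriv j φ) x := by
  funext x
  have hg : DifferentiableAt ℝ (gradient φ) x :=
    (contDiff_gradient hφ (m := 1) (by norm_num)).differentiable (by norm_num) x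
  have hcomp : fderiv ℝ (fun x => f (gradient φ x)) x
      = (fderiv ℝ f (gradient φ x)).comp (fderiv ℝ (gradient φ) x) :=
    fderiv_comp x (hf _) hg
  rw [partialDeriv, hcomp, ContinuousLinearMap.comp_apply, fderiv_apply_eq_sum]
  refine Finset.sum_congr rfl fun j _ => ?_
  congr 1
  have h := ((EuclideanSpace.proj (𝕜 := ℝ) j).hasFDerivAt.comp x hg.hasFDerivAt).fderiv
  have h' : (EuclideanSpace.proj (𝕜 := ℝ) j : EuclideanSpace ℝ (Fin d) → ℝ) ∘ gradient φ
      = partialDeriv j φ := by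
    funext y
    simp [gradient_apply]
  rw [h'] at h
  rw [partialDeriv, h]
  simp

lemma laplacian_comp_gradient {f φ : EuclideanSpace ℝ (Fin d) → ℝ}
    (hf : ContDiff ℝ 2 f) (hφ : ContDiff ℝ 3 φ) (x : EuclideanSpace ℝ (Fin d)) :
    laplacian (fun x => f (gradient φ x)) x =
      ⟪gradient f (gradient φ x), gradient (laplacian φ) x⟫
        + (hessianMatrix φ x * hessianMatrix f (gradient φ x) * hessianMatrix φ x).trace := by
  have hφ2 : ContDiff ℝ 2 φ := hφ.of_le (by norm_num)
  have hφ' : ∀ j, ContDiff ℝ 2 (partialDeriv j φ) := fun j => hφ.partialDeriv (by norm_num) j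
  have hf' : ∀ j, Differentiable ℝ (partialDeriv j f) := fun j =>
    (hf.partialDeriv (m := 1) (by norm_num) j).differentiable (by norm_num)
  have hg : ContDiff ℝ 2 (gradient φ) := contDiff_gradient hφ (by norm_num)
  have hfg : ∀ j, Differentiable ℝ (fun x => partialDeriv j f (gradient φ x)) := fun j =>
    (hf' j).comp (hg.differentiable (by norm_num))
  have hφ'' : ∀ i j, Differentiable ℝ (partialDeriv i (partialDeriv j φ)) := fun i j =>
    ((hφ' j).partialDeriv (m := 1) (by norm_num) i).differentiable (by norm_num)
  have key : ∀ i, partialDeriv i (partialDeriv i (fun x => f (gradient φ x))) x =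
      ∑ j, ((∑ k, partialDeriv k (partialDeriv j f) (gradient φ x)
          * partialDeriv i (partialDeriv k φ) x) * partialDeriv i (partialDeriv j φ) x
        + partialDeriv j f (gradient φ x)
          * partialDeriv i (partialDeriv i (partialDeriv j φ)) x) := by
    intro i
    rw [partialDeriv_comp_gradient (hf.differentiable (by norm_num)) hφ2,
      partialDeriv_sum (fun j => (hfg j).fun_mul (hφ'' i j))]
    refine Finset.sum_congr rfl fun j _ => ?_
    rw [partialDeriv_mul (hfg j) (hφ'' i j), partialDeriv_comp_gradient (hf' j) hφ2]
  rw [laplacian_eq_sum (hf.fun_comp hg)]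
  simp_rw [key, Finset.sum_add_distrib]
  rw [add_comm]
  congr 1
  · rw [PiLp.inner_apply, Finset.sum_comm]
    refine Finset.sum_congr rfl fun j _ => ?_
    rw [gradient_apply, gradient_apply, partialDeriv_laplacian hφ, laplacian_eq_sum (hφ' j)]
    simp [Finset.sum_mul, mul_comm]
  · simp only [Matrix.trace, Matrix.diag, Matrix.mul_apply, hessianMatrix_apply hφ2,
      hessianMatrix_apply hf]
    refine Finset.sum_congr rfl fun i _ => Finset.sum_congr rfl fun j _ => ?_
    rw [partialDeriv_comm hφ2 i j]
    congr 1
    exact Finset.sum_congr rfl fun k _ => mul_comm _ _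

end PartialDeriv

/-- The second derivative of a function at a continuity point which is a local minimum is
nonnegative. -/
lemma IsLocalMin.deriv_deriv_nonneg {f : ℝ → ℝ} {a : ℝ} (h : IsLocalMin f a)
    (hf : ContinuousAt f a) : 0 ≤ deriv (deriv f) a := by
  by_contra! hneg
  have hmax := isLocalMax_of_deriv_deriv_neg hneg h.deriv_eq_zero hf
  have hconst : f =ᶠ[nhds a] fun _ => f a := by
    filter_upwards [h, hmax] with y h1 h2 using le_antisymm h2 h1
  have := hconst.deriv.deriv_eq
  simp at this
  exact hneg.ne this

lemma laplacian_nonneg_of_forall_le {d : ℕ} {f : EuclideanSpace ℝ (Fin d) → ℝ}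
    (hf : ContDiff ℝ 2 f) {x : EuclideanSpace ℝ (Fin d)} (hx : ∀ y, f x ≤ f y) :
    0 ≤ laplacian f x := by
  rw [laplacian_eq_sum hf]
  refine Finset.sum_nonneg fun i _ => ?_
  have hderiv : ∀ {g : EuclideanSpace ℝ (Fin d) → ℝ}, Differentiable ℝ g →
      deriv (fun t : ℝ => g (x + t • EuclideanSpace.single i (1 : ℝ)))
        = fun t => partialDeriv i g (x + t • EuclideanSpace.single i (1 : ℝ)) := by
    intro g hg
    funext t
    have h1 : HasDerivAt (fun t : ℝ => x + t • EuclideanSpace.single i (1 : ℝ))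
        (EuclideanSpace.single i (1 : ℝ)) t := by
      simpa using ((hasDerivAt_id t).smul_const (EuclideanSpace.single i (1 : ℝ))).const_add x
    exact ((hg _).hasFDerivAt.comp_hasDerivAt t h1).deriv
  have hmin : IsLocalMin (fun t : ℝ => f (x + t • EuclideanSpace.single i (1 : ℝ))) 0 :=
    Filter.Eventually.of_forall fun t => by simpa using hx _
  have hcont := hf.continuous
  have := hmin.deriv_deriv_nonneg (by fun_prop)
  rw [hderiv (hf.differentiable (by norm_num)), hderiv
    ((hf.partialDeriv (m := 1) (by norm_num) i).differentiable (by norm_num))] at this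
  simpa using this

section LogDet

variable {n : Type*} [Fintype n] [DecidableEq n]

lemma Matrix.PosDef.log_det_le_trace_sub_card {A : Matrix n n ℝ} (hA : A.PosDef) :
    Real.log A.det ≤ A.trace - Fintype.card n := by
  rw [hA.isHermitian.det_eq_prod_eigenvalues, hA.isHermitian.trace_eq_sum_eigenvalues]
  simp only [RCLike.ofReal_real_eq_id, id]
  rw [Real.log_prod (fun i _ => (hA.eigenvalues_pos i).ne')]
  calc ∑ i, Real.log (hA.isHermitian.eigenvalues i)
      ≤ ∑ i, (hA.isHermitian.eigenvalues i - 1) :=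
        Finset.sum_le_sum fun i _ => Real.log_le_sub_one_of_pos (hA.eigenvalues_pos i)
    _ = _ := by simp

open scoped MatrixOrder Matrix.Norms.L2Operator in
/-- The tangent plane inequality for the concave function `log det`. -/
lemma Matrix.PosDef.log_det_le {A B : Matrix n n ℝ} (hA : A.PosDef) (hB : B.PosDef) :
    Real.log A.det ≤ Real.log B.det + ((B⁻¹ * A).trace - Fintype.card n) := by
  obtain ⟨P, hPu, hP⟩ : ∃ P : Matrix n n ℝ, IsUnit P ∧ B⁻¹ = Pᴴ * P :=
    CStarAlgebra.isStrictlyPositive_iff_eq_star_mul_self.mp hB.inv.isStrictlyPositive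
  have hC : (P * A * Pᴴ).PosDef := hA.mul_mul_conjTranspose_same
    (Matrix.vecMul_injective_of_isUnit hPu)
  have h := hC.log_det_le_trace_sub_card
  have htr : (P * A * Pᴴ).trace = (B⁻¹ * A).trace := by
    rw [Matrix.trace_mul_comm, ← Matrix.mul_assoc, hP]
  have hdet : (P * A * Pᴴ).det = B.det⁻¹ * A.det := by
    have := congrArg Matrix.det hP
    rw [Matrix.det_nonsing_inv, Ring.inverse_eq_inv', Matrix.det_mul] at this
    rw [this, Matrix.det_mul, Matrix.det_mul]
    ring
  rw [htr, hdet, Real.log_mul (inv_ne_zero hB.det_pos.ne') hA.det_pos.ne', Real.log_inv] at h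
  linarith

end LogDet

/-- Differentiating the log-Monge–Ampère equation twice: for
`V = W(∇φ) − log det ∇²φ`,
`ΔV ≥ ⟨∇W(∇φ), ∇Δφ⟩ + Tr(H ∇²W(∇φ) H) − Tr(H⁻¹ ∇²Δφ)` where `H = ∇²φ`. -/
theorem laplacian_monge_ampere_inequality {d : ℕ} (hd : 1 ≤ d)
    (φ : EuclideanSpace ℝ (Fin d) → ℝ) (hφ : ContDiff ℝ 4 φ)
    (hφpos : ∀ x, (hessianMatrix φ x).PosDef)
    (W : EuclideanSpace ℝ (Fin d) → ℝ) (hW : ContDiff ℝ 2 W)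
    (V : EuclideanSpace ℝ (Fin d) → ℝ)
    (hV : ∀ x, V x = W (gradient φ x) - Real.log (hessianMatrix φ x).det) :
    ∀ x : EuclideanSpace ℝ (Fin d),
      ⟪gradient W (gradient φ x), gradient (laplacian φ) x⟫
        + (hessianMatrix φ x * hessianMatrix W (gradient φ x) * hessianMatrix φ x).trace
        - ((hessianMatrix φ x)⁻¹ * hessianMatrix (laplacian φ) x).trace
      ≤ laplacian V x := by
  intro x
  have hφ2 : ContDiff ℝ 2 φ := hφ.of_le (by norm_num)
  have hφ3 : ContDiff ℝ 3 φ := hφ.of_le (by norm_num)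
  have h3 : ∀ k, ContDiff ℝ 3 (partialDeriv k φ) := fun k => hφ.partialDeriv (by norm_num) k
  have h2 : ∀ k l, ContDiff ℝ 2 (partialDeriv k (partialDeriv l φ)) := fun k l =>
    (h3 l).partialDeriv (by norm_num) k
  set A := (hessianMatrix φ x)⁻¹ with hA
  have hS : ∀ y, (A * hessianMatrix φ y).trace
      = ∑ p : Fin d × Fin d, A p.1 p.2 * partialDeriv p.2 (partialDeriv p.1 φ) y := by
    intro y
    rw [Fintype.sum_prod_type]
    simp [Matrix.trace, Matrix.mul_apply, hessianMatrix_apply hφ2]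
  have hSc : ContDiff ℝ 2 (fun y => (A * hessianMatrix φ y).trace) := by
    simp_rw [hS]
    exact ContDiff.sum fun p _ => contDiff_const.mul (h2 _ _)
  have hlogdet : ContDiff ℝ 2 (fun y => Real.log (hessianMatrix φ y).det) := by
    refine ContDiff.log ?_ fun y => (hφpos y).det_pos.ne'
    simp_rw [Matrix.det_apply, hessianMatrix_apply hφ2]
    exact ContDiff.sum fun σ _ => (contDiff_prod fun i _ => h2 _ _).const_smul _
  have hWc : ContDiff ℝ 2 (fun y => W (gradient φ y)) :=
    hW.comp (contDiff_gradient hφ3 (by norm_num))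
  have hLc := hSc.sub hlogdet
  have hlapS : laplacian (fun y => (A * hessianMatrix φ y).trace) x
      = (A * hessianMatrix (laplacian φ) x).trace := by
    have hlap : ContDiff ℝ 2 (laplacian φ) := by
      rw [laplacian_eq_sum hφ2]
      exact ContDiff.sum fun i _ => h2 i i
    simp_rw [hS]
    rw [laplacian_sum_const_mul (fun p => h2 _ _), Fintype.sum_prod_type]
    simp [Matrix.trace, Matrix.mul_apply, hessianMatrix_apply hlap, partialDeriv_laplacian hφ3,
      partialDeriv_laplacian (h3 _)]
  have hL : 0 ≤ laplacian
      (fun y => (A * hessianMatrix φ y).trace - Real.log (hessianMatrix φ y).det) x := by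
    refine laplacian_nonneg_of_forall_le hLc fun y => ?_
    have h := (hφpos y).log_det_le (hφpos x)
    have hx : A * hessianMatrix φ x = 1 :=
      Matrix.nonsing_inv_mul _ (hφpos x).det_pos.ne'.isUnit
    rw [hx, Matrix.trace_one]
    linarith
  have hVeq : V = fun y => W (gradient φ y)
      + ((A * hessianMatrix φ y).trace - Real.log (hessianMatrix φ y).det)
      - (A * hessianMatrix φ y).trace := by
    funext y
    rw [hV]
    ring
  rw [hVeq, laplacian_add_sub hWc hLc hSc, hlapS, laplacian_comp_gradient hW hφ3]
  linarith
end
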